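/- arXiv:1108.5237 — 6 statements merged into one kernel-verified Lean document; each statement's English description precedes it below -/
import Mathlib

section
/- Let f ∈ L¹(ℝ,ℂ) and let K ⊆ ℝ be a compact set such that f̂(ω) ≠ 0 for every ω ∈ K. Then there exists g ∈ L¹(ℝ,ℂ) whose Fourier transform ĝ has compact support and which satisfies ĝ(ω)·f̂(ω) = 1 for all ω ∈ K. Moreover, if f is a Schwartz function, then g may be chosen to be a Schwartz function (still with ĝ compactly supported). -/
open MeasureTheory Filter Topology

/-- The Fourier transform `f̂(ω) = ∫ e^{-iωt} f(t) dt` of an integrable function. -/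
noncomputable def fourierInt (f : ℝ → ℂ) (ω : ℝ) : ℂ :=
  ∫ t : ℝ, Complex.exp (-(Complex.I * ω * t)) * f t

open scoped FourierTransform Convolution

/-- A series of integrable functions with summable `L¹` norms has an integrable sum. -/
theorem integrable_tsum_of_summable_integral_norm {α : Type*} [MeasurableSpace α] {μ : Measure α}
    {F : ℕ → α → ℂ} (hF : ∀ n, Integrable (F n) μ) (hs : Summable fun n ↦ ∫ a, ‖F n a‖ ∂μ) :
    Integrable (fun a ↦ ∑' n, F n a) μ := by
  have key : ∑' n, ∫⁻ a, ‖F n a‖ₑ ∂μ ≠ ⊤ := by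
    have h (n : ℕ) : ∫⁻ a, ‖F n a‖ₑ ∂μ = ENNReal.ofReal (∫ a, ‖F n a‖ ∂μ) :=
      (ofReal_integral_norm_eq_lintegral_enorm (hF n)).symm
    simp_rw [h]
    exact hs.tsum_ofReal_ne_top
  have hsum : ∀ᵐ a ∂μ, Summable fun n ↦ ‖F n a‖ :=
    summable_norm_of_tsum_eLpNorm_ne_top le_rfl (fun n ↦ (hF n).1)
      (by simpa [eLpNorm_one_eq_lintegral_enorm] using key)
  refine ⟨aestronglyMeasurable_of_tendsto_ae (u := atTop)
    (f := fun n a ↦ ∑ i ∈ Finset.range n, F i a)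
    (fun n ↦ (integrable_finsetSum _ fun i _ ↦ hF i).1) ?_, ?_⟩
  · filter_upwards [hsum] with a ha
    exact ha.of_norm.hasSum.tendsto_sum_nat
  · calc ∫⁻ a, ‖∑' n, F n a‖ₑ ∂μ ≤ ∫⁻ a, ∑' n, ‖F n a‖ₑ ∂μ :=
          lintegral_mono fun a ↦ enorm_tsum_le_tsum_enorm
      _ = ∑' n, ∫⁻ a, ‖F n a‖ₑ ∂μ := lintegral_tsum fun n ↦ (hF n).1.enorm
      _ < ⊤ := key.lt_top

/-- Minkowski's integral inequality in `L¹`. -/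
theorem integral_norm_integral_le {F : ℝ × ℝ → ℂ} (hF : Integrable F) :
    ∫ x, ‖∫ t, F (x, t)‖ ≤ ∫ t, ∫ x, ‖F (x, t)‖ := by
  rw [← integral_integral_swap (f := fun x t ↦ ‖F (x, t)‖) hF.norm]
  exact integral_mono hF.integral_prod_left.norm hF.norm.integral_prod_left
    fun x ↦ norm_integral_le_integral_norm _

/-- Young's inequality in `L¹`. -/
theorem integral_norm_convolution_le {f g : ℝ → ℂ} (hf : Integrable f) (hg : Integrable g) :
    ∫ x, ‖(f ⋆[ContinuousLinearMap.mul ℂ ℂ] g) x‖ ≤ (∫ x, ‖f x‖) * ∫ x, ‖g x‖ := by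
  refine (integral_norm_integral_le
    (hf.convolution_integrand (ContinuousLinearMap.mul ℂ ℂ) hg)).trans_eq ?_
  simp_rw [ContinuousLinearMap.mul_apply', norm_mul, integral_const_mul,
    integral_sub_right_eq_self (fun x ↦ ‖g x‖), integral_mul_const]

/-- Neumann series in the convolution algebra `L¹(ℝ)`. -/
theorem exists_fourier_mul_one_sub_eq {u ψ : ℝ → ℂ} (hu : Integrable u) (hψ : Integrable ψ)
    (hu1 : ∫ t, ‖u t‖ < 1) :
    ∃ h : ℝ → ℂ, Integrable h ∧ ∀ ω, 𝓕 u ω ≠ 1 ∧ 𝓕 h ω * (1 - 𝓕 u ω) = 𝓕 ψ ω := by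
  let F : ℕ → ℝ → ℂ := fun n ↦ n.rec ψ fun _ h ↦ u ⋆[ContinuousLinearMap.mul ℂ ℂ] h
  have hF (n : ℕ) : Integrable (F n) := by
    induction n with
    | zero => exact hψ
    | succ n ih => exact hu.integrable_convolution _ ih
  have hnorm (n : ℕ) : ∫ t, ‖F n t‖ ≤ (∫ t, ‖u t‖) ^ n * ∫ t, ‖ψ t‖ := by
    induction n with
    | zero => simp [F]
    | succ n ih =>
      refine (integral_norm_convolution_le hu (hF n)).trans ?_
      rw [pow_succ', mul_assoc]
      gcongr
  have hfour (n : ℕ) (ω : ℝ) : 𝓕 (F n) ω = 𝓕 u ω ^ n * 𝓕 ψ ω := by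
    induction n with
    | zero => simp [F]
    | succ n ih =>
      rw [pow_succ', mul_assoc, ← ih]
      exact Real.fourier_mul_convolution_eq hu (hF n) ω
  have hsum : Summable fun n ↦ ∫ t, ‖F n t‖ :=
    .of_nonneg_of_le (fun n ↦ integral_nonneg fun t ↦ norm_nonneg _) hnorm
      ((summable_geometric_of_lt_one (integral_nonneg fun t ↦ norm_nonneg _) hu1).mul_right _)
  refine ⟨fun t ↦ ∑' n, F n t, integrable_tsum_of_summable_integral_norm hF hsum, fun ω ↦ ?_⟩
  have hω : ‖𝓕 u ω‖ < 1 :=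
    (VectorFourier.norm_fourierIntegral_le_integral_norm _ _ _ _ _).trans_lt hu1
  have h1 : HasSum (fun n ↦ 𝓕 (F n) ω) (𝓕 (fun t ↦ ∑' n, F n t) ω) := by
    have := hasSum_integral_of_summable_integral_norm (μ := volume)
      (F := fun n t ↦ Real.fourierChar (-(t * ω)) • F n t)
      (fun n ↦ by
        have := (Real.fourierIntegral_convergent_iff (μ := volume) (f := F n) ω).2 (hF n)
        simpa [mul_comm] using this) (by simpa using hsum)
    simpa only [Real.fourier_real_eq, tsum_const_smul'] using this
  have h2 := (hasSum_geometric_of_norm_lt_one hω).mul_right (𝓕 ψ ω)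
  simp_rw [hfour] at h1
  have h0 : 𝓕 u ω ≠ 1 := fun h ↦ by simp [h] at hω
  have h0' : 1 - 𝓕 u ω ≠ 0 := sub_ne_zero.2 h0.symm
  refine ⟨h0, ?_⟩
  rw [h1.unique h2]
  field_simp

/-- Translation is continuous in `L¹`. -/
theorem continuous_integral_norm_comp_sub_sub {φ : ℝ → ℂ} (hφ : Integrable φ) :
    Continuous fun s : ℝ ↦ ∫ t, ‖φ (t - s) - φ t‖ := by
  have hm := memLp_one_iff_integrable.2 hφ
  have : Fact ((1 : ENNReal) ≠ ⊤) := ⟨ENNReal.one_ne_top⟩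
  have : Continuous fun s : ℝ ↦ ‖(DomAddAct.mk (-s) +ᵥ hm.toLp φ) - hm.toLp φ‖ := by
    have : Continuous fun s : ℝ ↦ (DomAddAct.mk (-s) : ℝᵈᵃᵃ) :=
      DomAddAct.continuous_mk.comp continuous_neg
    exact ((this.vadd continuous_const).sub continuous_const).norm
  convert this using 2 with s
  rw [DomAddAct.mk_vadd_toLp, ← MemLp.toLp_sub, L1.norm_eq_integral_norm]
  refine integral_congr_ae ?_
  filter_upwards [MemLp.coeFn_toLp ((hm.comp_measurePreserving
    (measurePreserving_vadd (-s) volume)).sub hm)] with t ht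
  refine Eq.trans ?_ (congrArg norm ht).symm
  simp [sub_eq_neg_add]

theorem fourier_const_mul (a : ℂ) (f : ℝ → ℂ) (ω : ℝ) :
    𝓕 (fun t ↦ a * f t) ω = a * 𝓕 f ω := by
  simp_rw [Real.fourier_real_eq, ← integral_const_mul, mul_smul_comm]

theorem fourier_add_of_integrable {f g : ℝ → ℂ} (hf : Integrable f) (hg : Integrable g) (ω : ℝ) :
    𝓕 (fun t ↦ f t + g t) ω = 𝓕 f ω + 𝓕 g ω := by
  simp_rw [Real.fourier_eq, smul_add]
  exact integral_add ((Real.fourierIntegral_convergent_iff ω).2 hf)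
    ((Real.fourierIntegral_convergent_iff ω).2 hg)

theorem fourier_sub_of_integrable {f g : ℝ → ℂ} (hf : Integrable f) (hg : Integrable g) (ω : ℝ) :
    𝓕 (fun t ↦ f t - g t) ω = 𝓕 f ω - 𝓕 g ω := by
  simp_rw [Real.fourier_eq, smul_sub]
  exact integral_sub ((Real.fourierIntegral_convergent_iff ω).2 hf)
    ((Real.fourierIntegral_convergent_iff ω).2 hg)

theorem fourier_comp_mul_left (f : ℝ → ℂ) {c : ℝ} (hc : 0 < c) (ω : ℝ) :
    𝓕 (fun t ↦ (c : ℂ) * f (c * t)) ω = 𝓕 f (c⁻¹ * ω) := by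
  have key := Measure.integral_comp_mul_left
    (fun t ↦ Real.fourierChar (-(t * (c⁻¹ * ω))) • f t) c
  rw [Real.fourier_real_eq, Real.fourier_real_eq]
  calc _ = ∫ t : ℝ, (c : ℂ) * (Real.fourierChar (-(c * t * (c⁻¹ * ω))) • f (c * t)) := by
        refine integral_congr_ae (.of_forall fun t ↦ ?_)
        have : c * t * (c⁻¹ * ω) = t * ω := by field_simp
        simp only [this, mul_smul_comm]
    _ = _ := by
        rw [integral_const_mul, key, abs_of_pos (inv_pos.2 hc), Complex.real_smul, ← mul_assoc,
          ← Complex.ofReal_mul, mul_inv_cancel₀ hc.ne', Complex.ofReal_one, one_mul]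

theorem fourier_fourierChar_smul (f : ℝ → ℂ) (a ω : ℝ) :
    𝓕 (fun t ↦ Real.fourierChar (t * a) • f t) ω = 𝓕 f (ω - a) := by
  rw [Real.fourier_real_eq, Real.fourier_real_eq]
  refine integral_congr_ae (.of_forall fun t ↦ ?_)
  simp only [smul_smul, ← AddChar.map_add_eq_mul]
  congr 2
  ring

theorem integrable_fourierChar_smul {f : ℝ → ℂ} (hf : Integrable f) (a : ℝ) :
    Integrable (fun t ↦ Real.fourierChar (t * a) • f t) := by
  have := (Real.fourierIntegral_convergent_iff (μ := volume) (f := f) (-a)).2 hf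
  simpa [mul_comm] using this

/-- If `f_c(t) = c f(c t)` and `u = f̂(0) φ - f_c ⋆ φ`, then `u` is small in `L¹` for large `c`. -/
theorem exists_small_fourier_eq {f φ : ℝ → ℂ} (hf : Integrable f) (hφ : Integrable φ) {ε : ℝ}
    (hε : 0 < ε) :
    ∃ c : ℝ, 0 < c ∧ ∃ u : ℝ → ℂ, Integrable u ∧ ∫ t, ‖u t‖ < ε ∧
      ∀ ω, 𝓕 u ω = (𝓕 f 0 - 𝓕 f (c⁻¹ * ω)) * 𝓕 φ ω := by
  set M : ℝ → ℝ := fun s ↦ ∫ t, ‖φ (t - s) - φ t‖ with hM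
  have hMc : Continuous M := continuous_integral_norm_comp_sub_sub hφ
  have hMb (s : ℝ) : ‖M s‖ ≤ 2 * ∫ t, ‖φ t‖ := by
    rw [Real.norm_of_nonneg (integral_nonneg fun t ↦ norm_nonneg _)]
    calc M s ≤ ∫ t, (‖φ (t - s)‖ + ‖φ t‖) :=
          integral_mono ((hφ.comp_sub_right s).sub hφ).norm
            ((hφ.comp_sub_right s).norm.add hφ.norm) fun t ↦ norm_sub_le _ _
      _ = _ := by
          rw [integral_add (hφ.comp_sub_right s).norm hφ.norm,
            integral_sub_right_eq_self (fun t ↦ ‖φ t‖)]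
          ring
  have hlim : Tendsto (fun c : ℝ ↦ ∫ t, ‖f t‖ * M (c⁻¹ * t)) atTop (𝓝 0) := by
    have h := tendsto_integral_filter_of_dominated_convergence (μ := volume) (l := atTop)
      (F := fun (c : ℝ) t ↦ ‖f t‖ * M (c⁻¹ * t)) (f := fun _ ↦ (0 : ℝ))
      (fun t ↦ ‖f t‖ * (2 * ∫ t, ‖φ t‖))
      (.of_forall fun c ↦ hf.1.norm.mul
        (hMc.comp (continuous_const_mul c⁻¹)).aestronglyMeasurable)
      (.of_forall fun c ↦ .of_forall fun t ↦ by
        rw [norm_mul, norm_norm]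
        gcongr
        exact hMb _)
      (hf.norm.mul_const _)
      (.of_forall fun t ↦ by
        have h0 : Tendsto (fun c : ℝ ↦ c⁻¹ * t) atTop (𝓝 0) := by
          simpa using tendsto_inv_atTop_zero.mul_const t
        simpa [hM] using ((hMc.tendsto 0).comp h0).const_mul ‖f t‖)
    simpa using h
  obtain ⟨c, hcε, hc⟩ := ((hlim.eventually_lt_const hε).and (eventually_gt_atTop 0)).exists
  set k : ℝ → ℂ := fun t ↦ c * f (c * t) with hk
  have hki : Integrable k := (hf.comp_mul_left' hc.ne').const_mul _
  have hkint : ∫ t, k t = 𝓕 f 0 := by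
    simpa [Real.fourier_real_eq, hk] using fourier_comp_mul_left f hc 0
  set L := ContinuousLinearMap.mul ℂ ℂ
  have hconv := hki.convolution_integrand (μ := volume) (ν := volume) L hφ
  refine ⟨c, hc, fun x ↦ 𝓕 f 0 * φ x - (k ⋆[L] φ) x,
    (hφ.const_mul _).sub (hki.integrable_convolution L hφ), ?_, fun ω ↦ ?_⟩
  · have hF : Integrable fun p : ℝ × ℝ ↦ φ p.1 * k p.2 - L (k p.2) (φ (p.1 - p.2)) :=
      (hφ.mul_prod hki).sub hconv
    have hu : ∀ᵐ x, ‖𝓕 f 0 * φ x - (k ⋆[L] φ) x‖ =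
        ‖∫ t, (φ x * k t - L (k t) (φ (x - t)))‖ := by
      filter_upwards [hconv.prod_right_ae] with x hx
      rw [integral_sub (hki.const_mul _) hx, integral_const_mul, hkint, mul_comm]
      rfl
    rw [integral_congr_ae hu]
    refine (integral_norm_integral_le hF).trans_lt (lt_of_eq_of_lt ?_ hcε)
    calc ∫ t, ∫ x, ‖φ x * k t - L (k t) (φ (x - t))‖
        = ∫ t, c * (‖f (c * t)‖ * M (c⁻¹ * (c * t))) := by
          refine integral_congr_ae (.of_forall fun t ↦ ?_)
          simp only [hM, inv_mul_cancel_left₀ hc.ne']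
          rw [← integral_const_mul, ← integral_const_mul]
          refine integral_congr_ae (.of_forall fun x ↦ ?_)
          simp only [L, ContinuousLinearMap.mul_apply', hk]
          rw [mul_comm (φ x), ← mul_sub, norm_mul, norm_mul, Complex.norm_real,
            Real.norm_of_nonneg hc.le, norm_sub_rev, mul_assoc]
      _ = ∫ t, ‖f t‖ * M (c⁻¹ * t) := by
          rw [integral_const_mul, Measure.integral_comp_mul_left (fun t ↦ ‖f t‖ * M (c⁻¹ * t)),
            abs_of_pos (inv_pos.2 hc), smul_eq_mul, mul_inv_cancel_left₀ hc.ne']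
  · rw [fourier_sub_of_integrable (hφ.const_mul _) (hki.integrable_convolution L hφ),
      fourier_const_mul, Real.fourier_mul_convolution_eq hki hφ, fourier_comp_mul_left f hc,
      sub_mul]

/-- A smooth compactly supported function is the Fourier transform of a Schwartz function. -/
theorem exists_schwartzMap_fourier_eq {b : ℝ → ℂ} (hb : HasCompactSupport b)
    (hb' : ContDiff ℝ (⊤ : ℕ∞) b) : ∃ φ : SchwartzMap ℝ ℂ, 𝓕 (φ : ℝ → ℂ) = b := by
  refine ⟨𝓕⁻ (hb.toSchwartzMap hb'), ?_⟩
  rw [← SchwartzMap.fourier_coe, FourierTransform.fourier_fourierInv_eq]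
  rfl

theorem exists_local_inverse_zero {f : ℝ → ℂ} (hf : Integrable f) (h0 : 𝓕 f 0 ≠ 0) :
    ∃ g : ℝ → ℂ, Integrable g ∧ HasCompactSupport (𝓕 g) ∧
      ∀ᶠ ω in 𝓝 0, 𝓕 g ω * 𝓕 f ω = 1 := by
  let b : ContDiffBump (0 : ℝ) := ⟨1, 2, one_pos, one_lt_two⟩
  obtain ⟨φ, hφ⟩ := exists_schwartzMap_fourier_eq (b := fun x ↦ (b x : ℂ))
    (b.hasCompactSupport.comp_left Complex.ofReal_zero) (Complex.ofRealCLM.contDiff.comp b.contDiff)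
  obtain ⟨c, hc, u, hu, hu1, hfu⟩ :=
    exists_small_fourier_eq hf φ.integrable (norm_pos_iff.2 h0)
  obtain ⟨h, hh, hfh⟩ := exists_fourier_mul_one_sub_eq (hu.const_mul (𝓕 f 0)⁻¹) φ.integrable (by
    simp_rw [norm_mul, norm_inv, integral_const_mul]
    rwa [inv_mul_lt_iff₀ (norm_pos_iff.2 h0), mul_one])
  have hg (ω : ℝ) : 𝓕 (fun t ↦ (𝓕 f 0)⁻¹ * ((c⁻¹ : ℝ) * h (c⁻¹ * t))) ω =
      (𝓕 f 0)⁻¹ * 𝓕 h (c * ω) := by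
    rw [fourier_const_mul, fourier_comp_mul_left h (inv_pos.2 hc), inv_inv]
  refine ⟨fun t ↦ (𝓕 f 0)⁻¹ * ((c⁻¹ : ℝ) * h (c⁻¹ * t)),
    ((hh.comp_mul_left' (inv_ne_zero hc.ne')).const_mul _).const_mul _, ?_, ?_⟩
  · have hsupp : HasCompactSupport (𝓕 h) := by
      have : HasCompactSupport (𝓕 (φ : ℝ → ℂ)) := by
        rw [hφ]
        exact b.hasCompactSupport.comp_left Complex.ofReal_zero
      refine this.mono fun ω hω h' ↦ hω ?_
      have := (hfh ω).2
      rw [h', mul_eq_zero, sub_eq_zero] at this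
      exact this.resolve_right (hfh ω).1.symm
    rw [funext hg]
    exact (hsupp.comp_homeomorph (Homeomorph.mulLeft₀ c hc.ne')).mul_left
  · have hb : ∀ᶠ ω in 𝓝 (0 : ℝ), b (c * ω) = 1 := by
      have : Tendsto (fun ω : ℝ ↦ c * ω) (𝓝 0) (𝓝 0) :=
        (continuous_const_mul c).tendsto' _ _ (mul_zero c)
      exact this.eventually b.eventuallyEq_one
    filter_upwards [hb] with ω hω
    have := (hfh (c * ω)).2
    simp only [fourier_const_mul, hfu, hφ, hω, inv_mul_cancel_left₀ hc.ne'] at this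
    rw [hg, ← Complex.ofReal_one, ← this]
    field_simp
    simp

theorem exists_local_inverse {f : ℝ → ℂ} (hf : Integrable f) {a : ℝ} (ha : 𝓕 f a ≠ 0) :
    ∃ g : ℝ → ℂ, Integrable g ∧ HasCompactSupport (𝓕 g) ∧
      ∀ᶠ ω in 𝓝 a, 𝓕 g ω * 𝓕 f ω = 1 := by
  have hfa := fourier_fourierChar_smul f (-a)
  obtain ⟨g, hg, hgs, hgf⟩ := exists_local_inverse_zero (integrable_fourierChar_smul hf (-a))
    (by rwa [hfa, zero_sub, neg_neg])
  refine ⟨_, integrable_fourierChar_smul hg a, ?_, ?_⟩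
  · rw [funext (fourier_fourierChar_smul g a)]
    exact hgs.comp_homeomorph (Homeomorph.subRight a)
  · have : Tendsto (fun ω ↦ ω - a) (𝓝 a) (𝓝 0) :=
      (continuous_sub_right a).tendsto' _ _ (sub_self a)
    filter_upwards [this.eventually hgf] with ω hω
    rwa [hfa, sub_neg_eq_add, sub_add_cancel, ← fourier_fourierChar_smul] at hω

/-- The local form of Wiener's lemma, for the Fourier transform of Mathlib. -/
theorem exists_fourier_mul_eq_one {f : ℝ → ℂ} (hf : Integrable f) {K : Set ℝ} (hK : IsCompact K)
    (hfK : ∀ ω ∈ K, 𝓕 f ω ≠ 0) :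
    ∃ g : ℝ → ℂ, Integrable g ∧ HasCompactSupport (𝓕 g) ∧ ∀ ω ∈ K, 𝓕 g ω * 𝓕 f ω = 1 := by
  refine hK.induction_on (p := fun s ↦ ∃ g : ℝ → ℂ, Integrable g ∧ HasCompactSupport (𝓕 g) ∧
    ∀ ω ∈ s, 𝓕 g ω * 𝓕 f ω = 1) ?_ ?_ ?_ ?_
  · refine ⟨0, integrable_zero _ _ _, ?_, by simp⟩
    convert HasCompactSupport.zero
    ext ω
    simp [Real.fourier_eq]
  · rintro s t hst ⟨g, hg, hgs, hgt⟩
    exact ⟨g, hg, hgs, fun ω hω ↦ hgt ω (hst hω)⟩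
  · rintro s t ⟨g, hg, hgs, hgf⟩ ⟨h, hh, hhs, hhf⟩
    set L := ContinuousLinearMap.mul ℂ ℂ
    have hfh := hf.integrable_convolution L hh
    have hgfh := hg.integrable_convolution L hfh
    have key (ω : ℝ) : 𝓕 (g + h - g ⋆[L] (f ⋆[L] h)) ω =
        𝓕 g ω + 𝓕 h ω - 𝓕 g ω * (𝓕 f ω * 𝓕 h ω) := by
      rw [← Real.fourier_mul_convolution_eq hf hh, ← Real.fourier_mul_convolution_eq hg hfh,
        ← fourier_add_of_integrable hg hh]
      exact fourier_sub_of_integrable (hg.add hh) hgfh ω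
    refine ⟨_, (hg.add hh).sub hgfh, ?_, ?_⟩
    · rw [funext key]
      exact (hgs.add hhs).sub hgs.mul_right
    · rintro ω (hω | hω) <;> rw [key]
      · linear_combination (1 - 𝓕 f ω * 𝓕 h ω) * hgf ω hω
      · linear_combination (1 - 𝓕 f ω * 𝓕 g ω) * hhf ω hω
  · intro a ha
    obtain ⟨g, hg, hgs, hgf⟩ := exists_local_inverse hf (hfK a ha)
    exact ⟨_, mem_nhdsWithin_of_mem_nhds hgf, g, hg, hgs, fun ω hω ↦ hω⟩

theorem exists_schwartzMap_fourier_mul_eq_one (f : SchwartzMap ℝ ℂ) {K : Set ℝ}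
    (hK : IsCompact K) (hfK : ∀ ω ∈ K, 𝓕 (f : ℝ → ℂ) ω ≠ 0) :
    ∃ g : SchwartzMap ℝ ℂ, HasCompactSupport (𝓕 (g : ℝ → ℂ)) ∧
      ∀ ω ∈ K, 𝓕 (g : ℝ → ℂ) ω * 𝓕 (f : ℝ → ℂ) ω = 1 := by
  rw [← SchwartzMap.fourier_coe] at hfK ⊢
  set F : SchwartzMap ℝ ℂ := 𝓕 f
  have hU : IsOpen {ω | F ω ≠ 0} := isOpen_ne_fun F.continuous continuous_const
  obtain ⟨V, hV, hKV, hVU⟩ := exists_compact_between hK hU hfK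
  obtain ⟨χ, hχ1, hχ0, -⟩ := exists_contMDiffMap_one_nhds_of_subset_interior (n := (⊤ : ℕ∞))
    (modelWithCornersSelf ℝ ℝ) hK.isClosed hKV
  have hG : ContDiff ℝ (⊤ : ℕ∞) fun ω ↦ (χ ω : ℂ) / F ω := by
    refine contDiff_iff_contDiffAt.2 fun ω ↦ ?_
    by_cases hω : ω ∈ V
    · exact (Complex.ofRealCLM.contDiff.comp χ.contMDiff.contDiff).contDiffAt.mul
        ((F.smooth _).contDiffAt.inv (hVU hω))
    · refine (contDiffAt_const (c := (0 : ℂ))).congr_of_eventuallyEq ?_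
      filter_upwards [hV.isClosed.isOpen_compl.mem_nhds hω] with x hx
      simp [hχ0 x hx]
  have hGs : HasCompactSupport fun ω ↦ (χ ω : ℂ) / F ω :=
    .intro hV fun x hx ↦ by simp [hχ0 x hx]
  obtain ⟨g, hg⟩ := exists_schwartzMap_fourier_eq hGs hG
  refine ⟨g, hg ▸ hGs, fun ω hω ↦ ?_⟩
  have h1 : χ ω = 1 := hχ1.self_of_nhdsSet ω hω
  have h2 : F ω ≠ 0 := hfK ω hω
  simp only [hg, h1, Complex.ofReal_one]
  exact one_div_mul_cancel h2

theorem fourierInt_eq_fourier (f : ℝ → ℂ) (ω : ℝ) :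
    fourierInt f ω = 𝓕 f ((2 * Real.pi)⁻¹ * ω) := by
  rw [fourierInt, Real.fourier_real_eq_integral_exp_smul]
  refine integral_congr_ae (.of_forall fun t ↦ ?_)
  simp only [smul_eq_mul]
  congr 2
  push_cast
  field_simp

/-- If `f ∈ L¹(ℝ,ℂ)` and `K ⊆ ℝ` is compact with `f̂ ≠ 0` on `K`, then there is
`g ∈ L¹(ℝ,ℂ)` with `ĝ` compactly supported and `ĝ·f̂ = 1` on `K`; moreover if `f` is a Schwartz
function then `g` may be chosen Schwartz (still with `ĝ` compactly supported). -/
theorem exists_inverse_on_compact (f : ℝ → ℂ) (hf : Integrable f)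
    (K : Set ℝ) (hK : IsCompact K) (hfK : ∀ ω ∈ K, fourierInt f ω ≠ 0) :
    (∃ g : ℝ → ℂ, Integrable g ∧ HasCompactSupport (fun ω => fourierInt g ω) ∧
      ∀ ω ∈ K, fourierInt g ω * fourierInt f ω = 1) ∧
    (∀ fS : SchwartzMap ℝ ℂ, (∀ t, fS t = f t) →
      ∃ gS : SchwartzMap ℝ ℂ, HasCompactSupport (fun ω => fourierInt (⇑gS) ω) ∧
        ∀ ω ∈ K, fourierInt (⇑gS) ω * fourierInt f ω = 1) := by
  have hpi : (2 * Real.pi)⁻¹ ≠ 0 := by positivity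
  have hsupp {g : ℝ → ℂ} (hg : HasCompactSupport (𝓕 g)) :
      HasCompactSupport fun ω ↦ fourierInt g ω := by
    simp_rw [fourierInt_eq_fourier]
    exact hg.comp_homeomorph (Homeomorph.mulLeft₀ _ hpi)
  have hK' := hK.image (continuous_const_mul (2 * Real.pi)⁻¹)
  have hfK' : ∀ ω ∈ (fun ω ↦ (2 * Real.pi)⁻¹ * ω) '' K, 𝓕 f ω ≠ 0 := by
    rintro _ ⟨ω, hω, rfl⟩
    rw [← fourierInt_eq_fourier]
    exact hfK ω hω
  constructor
  · obtain ⟨g, hg, hgs, hgf⟩ := exists_fourier_mul_eq_one hf hK' hfK'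
    refine ⟨g, hg, hsupp hgs, fun ω hω ↦ ?_⟩
    rw [fourierInt_eq_fourier, fourierInt_eq_fourier]
    exact hgf _ ⟨ω, hω, rfl⟩
  · intro fS hfS
    obtain rfl : ⇑fS = f := funext hfS
    obtain ⟨g, hgs, hgf⟩ := exists_schwartzMap_fourier_mul_eq_one fS hK' hfK'
    refine ⟨g, hsupp hgs, fun ω hω ↦ ?_⟩
    rw [fourierInt_eq_fourier, fourierInt_eq_fourier]
    exact hgf _ ⟨ω, hω, rfl⟩
end

section
/- Let X be a complex Banach space and let F : ℝ → X be absolutely regular with F(t) = 0 for almost every t < 0. Then for every Schwartz function φ : ℝ → ℂ, the convolution F∗φ satisfies ‖(F∗φ)(t)‖ → 0 as t → −∞. -/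
open MeasureTheory Filter Topology

/-- A function `F : ℝ → X` is absolutely regular: strongly measurable, locally Bochner
integrable, and `t ↦ φ(t) • F(t)` is Bochner integrable for every Schwartz `φ`. -/
def AbsolutelyRegular {X : Type*} [NormedAddCommGroup X] [NormedSpace ℂ X]
    (F : ℝ → X) : Prop :=
  StronglyMeasurable F ∧ LocallyIntegrable F ∧
    ∀ φ : SchwartzMap ℝ ℂ, Integrable (fun t => φ t • F t)

/-- The convolution `(F∗φ)(t) = ∫ φ(t−s) • F(s) ds`. -/
noncomputable def convS {X : Type*} [NormedAddCommGroup X] [NormedSpace ℂ X]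
    (φ : ℝ → ℂ) (F : ℝ → X) (t : ℝ) : X :=
  ∫ s : ℝ, φ (t - s) • F s

/-- The supremum of `‖f u‖` over `r ≤ |u|`. -/
noncomputable def tailSup {E : Type*} [NormedAddCommGroup E] (f : ℝ → E) (r : ℝ) : ℝ :=
  sSup ((fun u => ‖f u‖) '' {u | r ≤ |u|})

section tailSup

variable {E : Type*} [NormedAddCommGroup E] {f : ℝ → E} {C : ℝ}

theorem norm_le_tailSup (hf : ∀ u, ‖f u‖ ≤ C) {r u : ℝ} (h : r ≤ |u|) :
    ‖f u‖ ≤ tailSup f r :=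
  le_csSup ⟨C, by rintro _ ⟨v, -, rfl⟩; exact hf v⟩ ⟨u, h, rfl⟩

theorem tailSup_le {r : ℝ} (h : ∀ u, r ≤ |u| → ‖f u‖ ≤ C) : tailSup f r ≤ C :=
  csSup_le ⟨_, r, le_abs_self r, rfl⟩ (by rintro _ ⟨v, hv, rfl⟩; exact h v hv)

theorem tailSup_nonneg (f : ℝ → E) (r : ℝ) : 0 ≤ tailSup f r :=
  Real.sSup_nonneg (by rintro _ ⟨v, -, rfl⟩; exact norm_nonneg _)

theorem antitone_tailSup (hf : ∀ u, ‖f u‖ ≤ C) : Antitone (tailSup f) :=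
  fun _ _ hrs => tailSup_le fun _ hu => norm_le_tailSup hf (hrs.trans hu)

theorem pow_mul_tailSup_abs_le {k : ℕ} (hf : ∀ u, (1 + |u|) ^ k * ‖f u‖ ≤ C) (x : ℝ) :
    (1 + |x|) ^ k * tailSup f |x| ≤ C := by
  have hx : 0 < (1 + |x|) ^ k := by positivity
  rw [mul_comm, ← le_div_iff₀ hx]
  refine tailSup_le fun u hu => ?_
  rw [le_div_iff₀ hx, mul_comm]
  exact le_trans (by gcongr) (hf u)

end tailSup

section Convolution

open scoped ContDiff Convolution

theorem iteratedDeriv_convolution_right {G ρ : ℝ → ℝ} (hG : LocallyIntegrable G)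
    (hρ : ContDiff ℝ ∞ ρ) (hρc : HasCompactSupport ρ) (n : ℕ) :
    iteratedDeriv n (G ⋆[ContinuousLinearMap.mul ℝ ℝ, volume] ρ) =
      G ⋆[ContinuousLinearMap.mul ℝ ℝ, volume] (iteratedDeriv n ρ) := by
  induction n generalizing ρ with
  | zero => simp
  | succ n ih =>
    have hd : deriv (G ⋆[ContinuousLinearMap.mul ℝ ℝ, volume] ρ) =
        G ⋆[ContinuousLinearMap.mul ℝ ℝ, volume] (deriv ρ) :=
      funext fun x => (hρc.hasDerivAt_convolution_right _ hG (hρ.of_le (by simp)) x).deriv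
    rw [iteratedDeriv_succ', iteratedDeriv_succ', hd,
      ih (contDiff_infty_iff_deriv.1 hρ).2 hρc.deriv]

theorem exists_pow_mul_norm_convolution_le {G h : ℝ → ℝ} {k : ℕ} {C : ℝ}
    (hG : ∀ x, (1 + |x|) ^ k * |G x| ≤ C) (hh : Continuous h) (hc : HasCompactSupport h) :
    ∃ D, ∀ x, (1 + |x|) ^ k * ‖(G ⋆[ContinuousLinearMap.mul ℝ ℝ, volume] h) x‖ ≤ D := by
  obtain ⟨R, hR⟩ := hc.isCompact.isBounded.subset_closedBall (0 : ℝ)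
  have hhi : Integrable h := hh.integrable_of_hasCompactSupport hc
  refine ⟨∫ t, (1 + |R|) ^ k * C * |h t|, fun x => ?_⟩
  rw [convolution_mul, ← integral_sub_left_eq_self (fun t => (1 + |R|) ^ k * C * |h t|) volume x]
  have hx : 0 ≤ (1 + |x|) ^ k := by positivity
  rw [← Real.norm_of_nonneg hx, ← norm_mul, ← integral_const_mul]
  refine norm_integral_le_of_norm_le ((hhi.abs.comp_sub_left x).const_mul _)
    (Eventually.of_forall fun t => ?_)
  rw [norm_mul, norm_mul, Real.norm_of_nonneg hx, Real.norm_eq_abs, Real.norm_eq_abs]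
  by_cases ht : h (x - t) = 0
  · simp [ht]
  have hxt : |x - t| ≤ |R| := by
    have := hR (subset_tsupport h ht)
    rw [mem_closedBall_zero_iff, Real.norm_eq_abs] at this
    exact this.trans (le_abs_self R)
  have hle : 1 + |x| ≤ (1 + |R|) * (1 + |t|) := by
    have h1 : |x| ≤ |x - t| + |t| := by simpa using abs_add_le (x - t) t
    nlinarith [abs_nonneg R, abs_nonneg t]
  calc (1 + |x|) ^ k * (|G t| * |h (x - t)|)
      ≤ ((1 + |R|) * (1 + |t|)) ^ k * (|G t| * |h (x - t)|) := by gcongr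
    _ = (1 + |R|) ^ k * ((1 + |t|) ^ k * |G t|) * |h (x - t)| := by rw [mul_pow]; ring
    _ ≤ (1 + |R|) ^ k * C * |h (x - t)| := by gcongr; exact hG t

/-- The convolution of a rapidly decaying function with a test function is a Schwartz function. -/
theorem exists_schwartzMap_eq_convolution {G ρ : ℝ → ℝ} (hGi : LocallyIntegrable G)
    (hG : ∀ k : ℕ, ∃ C, ∀ x, (1 + |x|) ^ k * |G x| ≤ C)
    (hρ : ContDiff ℝ ∞ ρ) (hρc : HasCompactSupport ρ) :
    ∃ ψ : SchwartzMap ℝ ℝ, ⇑ψ = G ⋆[ContinuousLinearMap.mul ℝ ℝ, volume] ρ := by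
  refine ⟨⟨_, hρc.contDiff_convolution_right _ hGi hρ, fun k n => ?_⟩, rfl⟩
  have hcn : HasCompactSupport (iteratedDeriv n ρ) := by
    rw [iteratedDeriv_eq_iterate]
    clear hρ
    induction n with
    | zero => exact hρc
    | succ n ih => rw [Function.iterate_succ_apply']; exact ih.deriv
  obtain ⟨C, hC⟩ := hG k
  obtain ⟨D, hD⟩ := exists_pow_mul_norm_convolution_le hC
    (hρ.continuous_iteratedDeriv n (mod_cast le_top)) hcn
  refine ⟨D, fun x => le_trans ?_ (hD x)⟩
  rw [norm_iteratedFDeriv_eq_norm_iteratedDeriv, iteratedDeriv_convolution_right hGi hρ hρc,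
    Real.norm_eq_abs x]
  gcongr
  linarith

/-- A rapidly decaying function is dominated, uniformly on tails, by a Schwartz function. -/
theorem exists_schwartzMap_norm_le {E : Type*} [NormedAddCommGroup E] {f : ℝ → E}
    (hf : ∀ k : ℕ, ∃ C, ∀ u, (1 + |u|) ^ k * ‖f u‖ ≤ C) :
    ∃ ψ : SchwartzMap ℝ ℝ, ∀ x u, |x| + 1 ≤ |u| → ‖f u‖ ≤ ψ x := by
  obtain ⟨C, hC⟩ : ∃ C, ∀ u, ‖f u‖ ≤ C := by simpa using hf 0
  have hanti := antitone_tailSup hC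
  let G : ℝ → ℝ := fun x => tailSup f |x|
  have hGi : LocallyIntegrable G := by
    refine (locallyIntegrable_const C).mono
      (hanti.measurable.comp measurable_id.abs).aestronglyMeasurable
      (Eventually.of_forall fun x => ?_)
    rw [Real.norm_of_nonneg (tailSup_nonneg _ _)]
    exact (tailSup_le fun u _ => hC u).trans (le_abs_self C)
  let b : ContDiffBump (0 : ℝ) := ⟨1 / 2, 1, by norm_num, by norm_num⟩
  obtain ⟨ψ, hψ⟩ := exists_schwartzMap_eq_convolution (ρ := b.normed volume) hGi
    (fun k => by
      obtain ⟨D, hD⟩ := hf k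
      refine ⟨D, fun x => ?_⟩
      rw [abs_of_nonneg (tailSup_nonneg _ _)]
      exact pow_mul_tailSup_abs_le hD x)
    b.contDiff_normed b.hasCompactSupport_normed
  refine ⟨ψ, fun x u hu => (norm_le_tailSup hC hu).trans ?_⟩
  have hint := b.hasCompactSupport_normed (μ := volume).convolutionExists_right
    (ContinuousLinearMap.mul ℝ ℝ) hGi b.continuous_normed x
  rw [hψ, convolution_mul]
  calc tailSup f (|x| + 1)
      = ∫ t, tailSup f (|x| + 1) * b.normed volume (x - t) := by
        rw [integral_const_mul, integral_sub_left_eq_self (b.normed volume) volume x,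
          b.integral_normed, mul_one]
    _ ≤ ∫ t, G t * b.normed volume (x - t) := by
        refine integral_mono ((b.integrable_normed.comp_sub_left x).const_mul _) hint fun t => ?_
        by_cases ht : b.normed volume (x - t) = 0
        · simp [ht]
        have hxt : x - t ∈ Metric.ball (0 : ℝ) 1 := by
          rw [← b.support_normed_eq (μ := volume)]
          exact ht
        rw [mem_ball_zero_iff, Real.norm_eq_abs] at hxt
        have h1 : |t| ≤ |x| + |x - t| := by
          simpa using abs_sub x (x - t)
        exact mul_le_mul_of_nonneg_right (hanti (by linarith)) (b.nonneg_normed _)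

end Convolution

/-- If `F : ℝ → X` is absolutely regular and vanishes a.e. on the negative
half-line, then for every Schwartz function `φ`, `‖(F∗φ)(t)‖ → 0` as `t → −∞`. -/
theorem conv_tendsto_zero_atBot {X : Type*} [NormedAddCommGroup X] [NormedSpace ℂ X]
    [CompleteSpace X] (F : ℝ → X) (hF : AbsolutelyRegular F)
    (hneg : ∀ᵐ t : ℝ, t < 0 → F t = 0) :
    ∀ φ : SchwartzMap ℝ ℂ, Tendsto (fun t => ‖convS (⇑φ) F t‖) atBot (𝓝 0) := by
  intro φ
  obtain ⟨hFm, -, hFi⟩ := hF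
  obtain ⟨ψ, hψ⟩ := exists_schwartzMap_norm_le (f := φ) fun k =>
    ⟨_, fun u => by
      simpa using SchwartzMap.one_add_le_sup_seminorm_apply (𝕜 := ℂ) (m := (k, 0))
        le_rfl le_rfl φ u⟩
  have hbound := (hFi (SchwartzMap.postcompCLM Complex.ofRealCLM ψ)).norm
  rw [← norm_zero (E := X), ← integral_zero ℝ X]
  refine (tendsto_integral_filter_of_dominated_convergence _
    (Eventually.of_forall fun t => ?_) ?_ hbound (Eventually.of_forall fun s => ?_)).norm
  · exact (φ.continuous.comp (continuous_const.sub continuous_id)).aestronglyMeasurable.smul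
      hFm.aestronglyMeasurable
  · filter_upwards [eventually_le_atBot (-1 : ℝ)] with t ht
    filter_upwards [hneg] with s hs
    rcases lt_or_ge s 0 with h | h
    · simp [hs h]
    · rw [norm_smul, norm_smul]
      gcongr
      refine (hψ s (t - s) ?_).trans ?_
      · rw [abs_of_nonneg h, abs_of_nonpos (by linarith)]
        linarith
      · simpa using le_abs_self (ψ s)
  · have h : Tendsto (fun t => φ (t - s)) atBot (𝓝 0) :=
      (φ.tendsto_cocompact.mono_left atBot_le_cocompact).comp
        (tendsto_atBot_add_const_right _ (-s) tendsto_id)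
    simpa using h.smul_const (F s)
end

section
/- For λ ∈ ℂ with Re λ > 0 define f_λ : ℝ → ℂ by f_λ(t) = e^{−λt} for t ≥ 0 and f_λ(t) = 0 for t < 0; for λ ∈ ℂ with Re λ < 0 define f_λ(t) = −e^{−λt} for t ≤ 0 and f_λ(t) = 0 for t > 0. Then the ℂ-linear span of { f_λ : λ ∈ ℂ, Re λ ≠ 0 } is dense in L¹(ℝ,ℂ). -/
open MeasureTheory Filter Topology

/-- For `Re λ > 0`, `f_λ(t) = e^{−λt}` for `t ≥ 0` and `0` for `t < 0`; for `Re λ < 0`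
(the `else` branch), `f_λ(t) = −e^{−λt}` for `t ≤ 0` and `0` for `t > 0`. -/
noncomputable def fLam (l : ℂ) : ℝ → ℂ := fun t =>
  if 0 < l.re then (if 0 ≤ t then Complex.exp (-l * t) else 0)
  else (if t ≤ 0 then -Complex.exp (-l * t) else 0)

/-- Every continuous complex-valued function on the line is a uniform limit on `[a, b]` of
complex polynomials. -/
theorem exists_complex_polynomial_near (a b : ℝ) (h : ℝ → ℂ) (hc : Continuous h) (δ : ℝ)
    (hδ : 0 < δ) :
    ∃ P : Polynomial ℂ, ∀ x ∈ Set.Icc a b, ‖h x - P.eval (x : ℂ)‖ ≤ δ := by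
  obtain ⟨p, hp⟩ := exists_polynomial_near_of_continuousOn a b (fun x => (h x).re)
    (Complex.continuous_re.comp hc).continuousOn (δ / 2) (half_pos hδ)
  obtain ⟨q, hq⟩ := exists_polynomial_near_of_continuousOn a b (fun x => (h x).im)
    (Complex.continuous_im.comp hc).continuousOn (δ / 2) (half_pos hδ)
  refine ⟨p.map (algebraMap ℝ ℂ) + Polynomial.C Complex.I * q.map (algebraMap ℝ ℂ), ?_⟩
  intro x hx
  have eval_map (r : Polynomial ℝ) : (r.map (algebraMap ℝ ℂ)).eval (x : ℂ) = (r.eval x : ℝ) :=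
    Polynomial.eval_map_apply (algebraMap ℝ ℂ) x
  rw [Polynomial.eval_add, Polynomial.eval_mul, Polynomial.eval_C, eval_map, eval_map]
  refine (Complex.norm_le_abs_re_add_abs_im _).trans ?_
  have hp' := hp x hx
  have hq' := hq x hx
  rw [abs_sub_comm] at hp' hq'
  simp only [Complex.sub_re, Complex.add_re, Complex.ofReal_re, Complex.mul_re, Complex.I_re,
    zero_mul, Complex.I_im, Complex.ofReal_im, mul_zero, sub_self, add_zero, Complex.sub_im,
    Complex.add_im, Complex.mul_im, one_mul, zero_add]
  linarith

theorem continuous_comp_neg_log_div (φ : ℝ → ℂ) (hc : Continuous φ) (hs : HasCompactSupport φ) :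
    Continuous fun x : ℝ => φ (-Real.log x) / (x : ℂ) := by
  rw [continuous_iff_continuousAt]
  intro x
  rcases eq_or_ne x 0 with rfl | hx
  · have h1 : Tendsto (fun x => -Real.log x) (𝓝[≠] 0) (cocompact ℝ) :=
      (tendsto_neg_atBot_atTop.comp Real.tendsto_log_nhdsNE_zero).mono_right atTop_le_cocompact
    have h2 : ∀ᶠ y in cocompact ℝ, φ y = 0 :=
      hasCompactSupport_iff_eventuallyEq.1 hs |>.filter_mono cocompact_le_coclosedCompact
    have h3 : ∀ᶠ x : ℝ in 𝓝 0, φ (-Real.log x) / (x : ℂ) = 0 := by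
      have := eventually_nhdsWithin_iff.1 (h1.eventually h2)
      filter_upwards [this] with x hx
      rcases eq_or_ne x 0 with rfl | h0
      · simp
      · simp [hx h0]
    exact (continuousAt_const (y := (0 : ℂ))).congr (h3.mono fun _ h => h.symm)
  · exact (hc.continuousAt.comp (Real.continuousAt_log hx).neg).div
      Complex.continuous_ofReal.continuousAt (by exact_mod_cast hx)

theorem exists_polynomial_exp_near (φ : ℝ → ℂ) (hc : Continuous φ) (hs : HasCompactSupport φ)
    (δ : ℝ) (hδ : 0 < δ) :
    ∃ P : Polynomial ℂ, ∀ t : ℝ, 0 ≤ t →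
      ‖φ t - Complex.exp (-t) * P.eval (Complex.exp (-t))‖ ≤ δ * Real.exp (-t) := by
  obtain ⟨P, hP⟩ := exists_complex_polynomial_near 0 1 _ (continuous_comp_neg_log_div φ hc hs) δ hδ
  refine ⟨P, fun t ht => ?_⟩
  have h := hP (Real.exp (-t)) ⟨(Real.exp_pos _).le, Real.exp_le_one_iff.2 (by linarith)⟩
  rw [Real.log_exp, neg_neg, Complex.ofReal_exp, Complex.ofReal_neg] at h
  have key : φ t - Complex.exp (-t) * P.eval (Complex.exp (-t)) =
      (φ t / Complex.exp (-t) - P.eval (Complex.exp (-t))) * Complex.exp (-t) := by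
    have := Complex.exp_ne_zero (-(t : ℂ))
    field_simp
  rw [key, norm_mul, Complex.norm_exp]
  simpa using mul_le_mul_of_nonneg_right h (Real.exp_pos (-t)).le

theorem fLam_natCast_add_one (n : ℕ) (t : ℝ) :
    fLam (n + 1) t = if 0 ≤ t then Complex.exp (-t) * Complex.exp (-t) ^ n else 0 := by
  have h : 0 < ((n : ℂ) + 1).re := by simp; positivity
  rw [fLam, if_pos h, ← Complex.exp_nat_mul, ← Complex.exp_add]
  ring_nf

theorem fLam_neg_natCast_add_one (n : ℕ) (t : ℝ) :
    fLam (-(n + 1)) t = if t ≤ 0 then -(Complex.exp t * Complex.exp t ^ n) else 0 := by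
  have h : ¬ 0 < (-((n : ℂ) + 1)).re := by simp; linarith [n.cast_nonneg (α := ℝ)]
  rw [fLam, if_neg h, ← Complex.exp_nat_mul, ← Complex.exp_add]
  ring_nf

theorem indicator_Ici_polynomial_exp_mem_span (P : Polynomial ℂ) :
    (fun t : ℝ => if 0 ≤ t then Complex.exp (-t) * P.eval (Complex.exp (-t)) else 0) ∈
      Submodule.span ℂ {g : ℝ → ℂ | ∃ l : ℂ, l.re ≠ 0 ∧ g = fLam l} := by
  have key : (fun t : ℝ => if 0 ≤ t then Complex.exp (-t) * P.eval (Complex.exp (-t)) else 0) =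
      ∑ n ∈ Finset.range (P.natDegree + 1), P.coeff n • fLam (n + 1) := by
    funext t
    simp only [Finset.sum_apply, Pi.smul_apply, fLam_natCast_add_one, smul_eq_mul]
    split_ifs
    · rw [Polynomial.eval_eq_sum_range, Finset.mul_sum]
      exact Finset.sum_congr rfl fun _ _ => by ring
    · simp
  rw [key]
  refine Submodule.sum_mem _ fun n _ => Submodule.smul_mem _ _ (Submodule.subset_span ⟨_, ?_, rfl⟩)
  have : (0 : ℝ) < n + 1 := by positivity
  simpa using this.ne'

theorem indicator_Iic_polynomial_exp_mem_span (P : Polynomial ℂ) :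
    (fun t : ℝ => if t ≤ 0 then Complex.exp t * P.eval (Complex.exp t) else 0) ∈
      Submodule.span ℂ {g : ℝ → ℂ | ∃ l : ℂ, l.re ≠ 0 ∧ g = fLam l} := by
  have key : (fun t : ℝ => if t ≤ 0 then Complex.exp t * P.eval (Complex.exp t) else 0) =
      ∑ n ∈ Finset.range (P.natDegree + 1), (-P.coeff n) • fLam (-(n + 1)) := by
    funext t
    simp only [Finset.sum_apply, Pi.smul_apply, fLam_neg_natCast_add_one, smul_eq_mul]
    split_ifs
    · rw [Polynomial.eval_eq_sum_range, Finset.mul_sum]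
      exact Finset.sum_congr rfl fun _ _ => by ring
    · simp
  rw [key]
  refine Submodule.sum_mem _ fun n _ => Submodule.smul_mem _ _ (Submodule.subset_span ⟨_, ?_, rfl⟩)
  have : (0 : ℝ) < n + 1 := by positivity
  rw [Complex.neg_re, neg_ne_zero]
  simpa using this.ne'

/-- A compactly supported continuous function is approximated, in the sup norm weighted by
`exp |t|`, by elements of the span of the `fLam l`. -/
theorem exists_mem_span_fLam_near (φ : ℝ → ℂ) (hc : Continuous φ) (hs : HasCompactSupport φ)
    (δ : ℝ) (hδ : 0 < δ) :
    ∃ g ∈ Submodule.span ℂ {g : ℝ → ℂ | ∃ l : ℂ, l.re ≠ 0 ∧ g = fLam l},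
      ∀ t : ℝ, t ≠ 0 → ‖φ t - g t‖ ≤ δ * Real.exp (-|t|) := by
  obtain ⟨P, hP⟩ := exists_polynomial_exp_near φ hc hs δ hδ
  obtain ⟨Q, hQ⟩ := exists_polynomial_exp_near (fun t => φ (-t)) (hc.comp continuous_neg)
    (hs.comp_homeomorph (Homeomorph.neg ℝ)) δ hδ
  refine ⟨_, Submodule.add_mem _ (indicator_Ici_polynomial_exp_mem_span P)
    (indicator_Iic_polynomial_exp_mem_span Q), fun t ht => ?_⟩
  rcases lt_or_gt_of_ne ht with h | h
  · simpa [h.not_ge, h.le, abs_of_neg h] using hQ (-t) (by linarith)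
  · simpa [h.not_ge, h.le, abs_of_pos h] using hP t h.le

theorem integrable_exp_neg_abs : Integrable fun t : ℝ => Real.exp (-|t|) := by
  rw [← integrableOn_univ, ← Set.Iic_union_Ioi (a := (0 : ℝ)), integrableOn_union]
  constructor
  · refine (integrableOn_exp_Iic 0).congr_fun (fun t ht => ?_) measurableSet_Iic
    simp [abs_of_nonpos (Set.mem_Iic.1 ht)]
  · refine (integrableOn_exp_neg_Ioi 0).congr_fun (fun t ht => ?_) measurableSet_Ioi
    simp [abs_of_pos (Set.mem_Ioi.1 ht)]

/-- The ℂ-linear span of `{ f_λ : Re λ ≠ 0 }` is dense in `L¹(ℝ,ℂ)`. -/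
theorem span_fLam_dense_L1 :
    ∀ f : ℝ → ℂ, Integrable f → ∀ ε : ℝ, 0 < ε →
      ∃ g ∈ Submodule.span ℂ {g : ℝ → ℂ | ∃ l : ℂ, l.re ≠ 0 ∧ g = fLam l},
        (∫ t : ℝ, ‖f t - g t‖) < ε := by
  intro f hf ε hε
  obtain ⟨φ, hs, hφ, hc, hi⟩ := hf.exists_hasCompactSupport_integral_sub_le (half_pos hε)
  have hexp : Integrable fun t : ℝ => Real.exp (-|t|) := integrable_exp_neg_abs
  have hfφ : Integrable fun t => ‖f t - φ t‖ := (hf.sub hi).norm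
  set C := ∫ t : ℝ, Real.exp (-|t|)
  have hC : 0 ≤ C := integral_nonneg fun t => (Real.exp_pos _).le
  obtain ⟨g, hg, hgφ⟩ := exists_mem_span_fLam_near φ hc hs (ε / 2 / (C + 1)) (by positivity)
  refine ⟨g, hg, ?_⟩
  have hle : (∫ t : ℝ, ‖f t - g t‖) ≤
      ∫ t : ℝ, (‖f t - φ t‖ + ε / 2 / (C + 1) * Real.exp (-|t|)) := by
    refine integral_mono_of_nonneg (ae_of_all _ fun t => norm_nonneg _)
      (hfφ.add (hexp.const_mul _)) ?_
    filter_upwards [Measure.ae_ne volume (0 : ℝ)] with t ht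
    exact (norm_sub_le_norm_sub_add_norm_sub _ (φ t) _).trans (by gcongr; exact hgφ t ht)
  rw [integral_add hfφ (hexp.const_mul _), integral_const_mul] at hle
  have hlt : ε / 2 / (C + 1) * C < ε / 2 := by
    rw [div_mul_eq_mul_div, div_lt_iff₀ (by positivity)]
    nlinarith
  linarith
end

section
/- Let X be a complex Banach space and let F : ℝ → X be absolutely regular. Suppose there exists a Schwartz function φ with φ̂(0) ≠ 0 such that F∗φ = 0 (identically). If the indefinite integral PF(t) = ∫₀^t F(s) ds is uniformly continuous on ℝ, then PF is bounded (hence bounded and uniformly continuous), and F is ergodic with mean 0, i.e. sup_{t∈ℝ} ‖(1/T)∫₀^T F(t+s) ds‖ → 0 as T → ∞. -/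
open MeasureTheory Filter Topology

/-- `F` is ergodic with mean `m`: `sup_{t∈ℝ} ‖(1/T)∫₀^T F(t+s) ds − m‖ → 0` as `T → ∞`. -/
def ErgodicWithMean {X : Type*} [NormedAddCommGroup X] [NormedSpace ℂ X]
    (F : ℝ → X) (m : X) : Prop :=
  ∀ ε : ℝ, 0 < ε → ∃ T₀ : ℝ, 0 < T₀ ∧ ∀ T : ℝ, T₀ ≤ T → ∀ t : ℝ,
    ‖T⁻¹ • (∫ s in (0:ℝ)..T, F (t + s)) - m‖ < ε

/-- A uniformly continuous function on `ℝ` has increments of at most linear growth. -/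
lemma UniformContinuous.exists_norm_sub_le_mul_one_add_abs {X : Type*} [NormedAddCommGroup X]
    {G : ℝ → X} (hG : UniformContinuous G) :
    ∃ C : ℝ, 0 ≤ C ∧ ∀ x y, ‖G x - G y‖ ≤ C * (1 + |x - y|) := by
  obtain ⟨δ, hδ, h⟩ := Metric.uniformContinuous_iff.1 hG 1 one_pos
  have key : ∀ n : ℕ, ∀ x y : ℝ, |x - y| ≤ n * (δ / 2) → ‖G x - G y‖ ≤ n := by
    intro n
    induction n with
    | zero =>
      intro x y hxy
      have : x = y := by
        have : |x - y| ≤ 0 := by simpa using hxy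
        linarith [abs_nonpos_iff.1 this]
      simp [this]
    | succ n ih =>
      intro x y hxy
      set z := y + (n / (n + 1) : ℝ) * (x - y) with hz
      have hn : (0 : ℝ) < n + 1 := by positivity
      have hxy' : |x - y| ≤ (n + 1) * (δ / 2) := by simpa using hxy
      have hzy : |z - y| ≤ n * (δ / 2) := by
        have : z - y = (n / (n + 1) : ℝ) * (x - y) := by rw [hz]; ring
        rw [this, abs_mul, abs_of_nonneg (by positivity), div_mul_eq_mul_div, div_le_iff₀ hn]
        calc (n : ℝ) * |x - y| ≤ n * ((n + 1) * (δ / 2)) := by gcongr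
          _ = _ := by ring
      have hxz : |x - z| < δ := by
        have : x - z = (x - y) / (n + 1) := by rw [hz]; field_simp; ring
        rw [this, abs_div, abs_of_pos hn, div_lt_iff₀ hn]
        nlinarith
      have h1 : ‖G x - G z‖ < 1 := by
        rw [← dist_eq_norm]; exact h (by rwa [Real.dist_eq])
      have h2 := ih z y hzy
      have h3 := norm_sub_le_norm_sub_add_norm_sub (G x) (G z) (G y)
      push_cast
      linarith
  refine ⟨1 + 2 / δ, by positivity, fun x y => ?_⟩
  have h1 := Nat.le_ceil (|x - y| / (δ / 2))
  have h2 := Nat.ceil_lt_add_one (a := |x - y| / (δ / 2)) (by positivity)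
  have h3 := key _ x y ((div_le_iff₀ (by positivity)).1 h1)
  have h4 : |x - y| / (δ / 2) = 2 / δ * |x - y| := by field_simp
  have h5 : 0 ≤ 2 / δ := by positivity
  have h6 := abs_nonneg (x - y)
  nlinarith

/-- Cubic decay of a Schwartz function. -/
lemma SchwartzMap.exists_norm_mul_one_add_abs_pow_le (f : SchwartzMap ℝ ℂ) :
    ∃ K : ℝ, 0 ≤ K ∧ ∀ x, ‖f x‖ * (1 + |x|) ^ 3 ≤ K := by
  refine ⟨2 ^ 3 * ((Finset.Iic (3, 0)).sup fun m => SchwartzMap.seminorm ℝ m.1 m.2) f,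
    by positivity, fun x => ?_⟩
  have := SchwartzMap.one_add_le_sup_seminorm_apply (𝕜 := ℝ) (m := (3, 0)) (k := 3) (n := 0)
    le_rfl le_rfl f x
  rw [norm_iteratedFDeriv_zero] at this
  rw [mul_comm]
  exact this

/-- A Schwartz function times a continuous function of linear growth is integrable. -/
lemma SchwartzMap.integrable_smul_of_linear_growth {X : Type*} [NormedAddCommGroup X]
    [NormedSpace ℂ X] {G : ℝ → X} (hG : Continuous G) {C : ℝ}
    (hC : ∀ s, ‖G s‖ ≤ C * (1 + |s|)) (f : SchwartzMap ℝ ℂ) :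
    Integrable (fun s => f s • G s) := by
  have h1 : Integrable (fun s => ‖f s‖) := f.integrable.norm
  have h2 : Integrable (fun s : ℝ => ‖s‖ ^ 1 * ‖f s‖) := f.integrable_pow_mul volume 1
  refine ((h1.add h2).const_mul C).mono' (f.continuous.smul hG).aestronglyMeasurable
    (.of_forall fun s => ?_)
  rw [norm_smul]
  calc ‖f s‖ * ‖G s‖ ≤ ‖f s‖ * (C * (1 + |s|)) := by gcongr; exact hC s
    _ = _ := by simp; ring

/-- Integration by parts of a `C¹` function against a locally integrable function. -/
lemma integral_smul_eq_sub_integral_deriv_smul_primitive {X : Type*} [NormedAddCommGroup X]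
    [NormedSpace ℂ X] [CompleteSpace X] {F : ℝ → X} (hF : LocallyIntegrable F)
    {ψ ψ' : ℝ → ℂ} (hψ : ∀ x, HasDerivAt ψ (ψ' x) x) (hψ' : Continuous ψ')
    {a b : ℝ} (hab : a ≤ b) :
    ∫ s in a..b, ψ s • F s = ψ b • (∫ s in (0:ℝ)..b, F s) - ψ a • (∫ s in (0:ℝ)..a, F s)
      - ∫ r in a..b, ψ' r • (∫ s in (0:ℝ)..r, F s) := by
  have hFi : ∀ x y, IntervalIntegrable F volume x y := fun x y =>
    (hF.integrableOn_isCompact isCompact_uIcc).intervalIntegrable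
  have hψc : Continuous ψ := continuous_iff_continuousAt.2 fun x => (hψ x).continuousAt
  have hGc : Continuous fun t => ∫ s in (0:ℝ)..t, F s :=
    intervalIntegral.continuous_primitive hFi 0
  set G : ℝ → X := fun t => ∫ s in (0:ℝ)..t, F s with hG
  have hψF : IntervalIntegrable (fun s => ψ s • F s) volume a b :=
    (hFi a b).continuousOn_smul hψc.continuousOn
  -- Fubini over the triangle `a < s ≤ r ≤ b`
  have hswap : ∫ r in a..b, ψ' r • (G r - G a) = ∫ s in a..b, (ψ b - ψ s) • F s := by
    rw [intervalIntegral.integral_of_le hab, intervalIntegral.integral_of_le hab]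
    have hint : Integrable (Function.uncurry fun r s : ℝ =>
        (Set.Iic r).indicator (fun s => ψ' r • F s) s)
        ((volume.restrict (Set.Ioc a b)).prod (volume.restrict (Set.Ioc a b))) := by
      have h1 : Integrable ψ' (volume.restrict (Set.Ioc a b)) :=
        (hψ'.intervalIntegrable a b).1
      have h2 : Integrable F (volume.restrict (Set.Ioc a b)) := (hFi a b).1
      have h3 := (h1.smul_prod h2).indicator
        (measurableSet_le (measurable_snd : Measurable (Prod.snd : ℝ × ℝ → ℝ)) measurable_fst)
      refine h3.congr (.of_forall fun p => ?_)
      simp [Function.uncurry, Set.indicator_apply]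
    calc ∫ r in Set.Ioc a b, ψ' r • (G r - G a)
        = ∫ r in Set.Ioc a b, ∫ s in Set.Ioc a b,
            (Set.Iic r).indicator (fun s => ψ' r • F s) s := by
          refine setIntegral_congr_fun measurableSet_Ioc fun r hr => ?_
          have : Set.Ioc a b ∩ Set.Iic r = Set.Ioc a r := by
            ext x; simp only [Set.mem_inter_iff, Set.mem_Ioc, Set.mem_Iic]
            exact ⟨fun h => ⟨h.1.1, h.2⟩, fun h => ⟨⟨h.1, h.2.trans hr.2⟩, h.2⟩⟩
          simp only [hG]
          rw [setIntegral_indicator measurableSet_Iic, this, integral_smul,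
            ← intervalIntegral.integral_of_le hr.1.le,
            intervalIntegral.integral_interval_sub_left (hFi _ _) (hFi _ _)]
      _ = ∫ s in Set.Ioc a b, ∫ r in Set.Ioc a b,
            (Set.Iic r).indicator (fun s => ψ' r • F s) s := integral_integral_swap hint
      _ = ∫ s in Set.Ioc a b, (ψ b - ψ s) • F s := by
          refine setIntegral_congr_fun measurableSet_Ioc fun s hs => ?_
          have h1 : (fun r => (Set.Iic r).indicator (fun s => ψ' r • F s) s)
              = (Set.Ici s).indicator (fun r => ψ' r • F s) := by
            ext r; simp [Set.indicator_apply]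
          have h2 : Set.Ioc a b ∩ Set.Ici s = Set.Icc s b := by
            ext x; simp only [Set.mem_inter_iff, Set.mem_Ioc, Set.mem_Icc, Set.mem_Ici]
            exact ⟨fun h => ⟨h.2, h.1.2⟩, fun h => ⟨⟨hs.1.trans_le h.1, h.2⟩, h.1⟩⟩
          simp only [h1]
          rw [setIntegral_indicator measurableSet_Ici, h2, integral_Icc_eq_integral_Ioc,
            integral_smul_const, ← intervalIntegral.integral_of_le hs.2,
            intervalIntegral.integral_eq_sub_of_hasDerivAt (fun x _ => hψ x)
              (hψ'.intervalIntegrable _ _)]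
  have hL : ∫ r in a..b, ψ' r • (G r - G a)
      = (∫ r in a..b, ψ' r • G r) - (ψ b - ψ a) • G a := by
    have e := intervalIntegral.integral_sub (μ := volume)
      ((hψ'.smul hGc).intervalIntegrable a b)
      ((hψ'.smul (continuous_const (y := G a))).intervalIntegrable a b)
    simp only [Pi.smul_apply'] at e
    simp only [smul_sub]
    rw [e, intervalIntegral.integral_smul_const,
      intervalIntegral.integral_eq_sub_of_hasDerivAt (fun x _ => hψ x)
              (hψ'.intervalIntegrable _ _)]
  have hR : ∫ s in a..b, (ψ b - ψ s) • F s
      = ψ b • (G b - G a) - ∫ s in a..b, ψ s • F s := by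
    simp only [sub_smul]
    have e := intervalIntegral.integral_sub ((hFi a b).smul (ψ b)) hψF
    simp only [Pi.smul_apply] at e
    rw [e, intervalIntegral.integral_smul]
    simp only [hG]
    rw [intervalIntegral.integral_interval_sub_left (hFi _ _) (hFi _ _)]
  rw [hL, hR] at hswap
  have : ∫ s in a..b, ψ s • F s = ψ b • (G b - G a)
      - ((∫ r in a..b, ψ' r • G r) - (ψ b - ψ a) • G a) := by rw [hswap]; abel
  rw [this]
  module

/-- A Schwartz function times a function of linear growth vanishes at infinity. -/
lemma SchwartzMap.tendsto_smul_zero_of_linear_growth {X : Type*} [NormedAddCommGroup X]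
    [NormedSpace ℂ X] {G : ℝ → X} {C : ℝ} (hC0 : 0 ≤ C)
    (hC : ∀ s, ‖G s‖ ≤ C * (1 + |s|)) (f : SchwartzMap ℝ ℂ) {l : Filter ℝ}
    (hl : Tendsto (fun x : ℝ => |x|) l atTop) :
    Tendsto (fun s => f s • G s) l (𝓝 0) := by
  obtain ⟨K, hK0, hK⟩ := f.exists_norm_mul_one_add_abs_pow_le
  refine squeeze_zero_norm (a := fun x => K * C * (1 + |x|)⁻¹) (fun x => ?_) ?_
  · have hx : (1 : ℝ) ≤ 1 + |x| := by linarith [abs_nonneg x]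
    rw [← div_eq_mul_inv, le_div_iff₀ (by linarith), norm_smul]
    calc ‖f x‖ * ‖G x‖ * (1 + |x|) ≤ ‖f x‖ * (C * (1 + |x|)) * (1 + |x|) := by
          gcongr; exact hC x
      _ = C * (‖f x‖ * (1 + |x|) ^ 2) := by ring
      _ ≤ C * (‖f x‖ * (1 + |x|) ^ 3) := by gcongr; norm_num
      _ ≤ C * K := by gcongr; exact hK x
      _ = _ := by ring
  · simpa using (tendsto_inv_atTop_zero.comp
      (tendsto_atTop_add_const_left l 1 hl)).const_mul (K * C)

/-- Integration by parts on `ℝ` of a Schwartz function against a function whose primitive has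
linear growth. -/
lemma SchwartzMap.integral_smul_eq_neg_integral_deriv_smul_primitive {X : Type*}
    [NormedAddCommGroup X] [NormedSpace ℂ X] [CompleteSpace X] {F : ℝ → X}
    (hF : LocallyIntegrable F) {C : ℝ} (hC0 : 0 ≤ C)
    (hC : ∀ t, ‖∫ s in (0:ℝ)..t, F s‖ ≤ C * (1 + |t|)) (ψ : SchwartzMap ℝ ℂ)
    (hψF : Integrable fun s => ψ s • F s) :
    ∫ s, ψ s • F s = -∫ r, deriv ψ r • (∫ s in (0:ℝ)..r, F s) := by
  have hGc : Continuous fun t => ∫ s in (0:ℝ)..t, F s :=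
    intervalIntegral.continuous_primitive (fun x y =>
      (hF.integrableOn_isCompact isCompact_uIcc).intervalIntegrable) 0
  have hL := intervalIntegral_tendsto_integral hψF tendsto_neg_atTop_atBot tendsto_id
  have hR := intervalIntegral_tendsto_integral
    ((SchwartzMap.derivCLM ℂ ℂ ψ).integrable_smul_of_linear_growth hGc hC)
    tendsto_neg_atTop_atBot tendsto_id
  have hb := ψ.tendsto_smul_zero_of_linear_growth hC0 hC tendsto_abs_atTop_atTop
  have ha := (ψ.tendsto_smul_zero_of_linear_growth hC0 hC tendsto_abs_atBot_atTop).comp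
    tendsto_neg_atTop_atBot
  have hlim := (hb.sub ha).sub hR
  rw [sub_zero, zero_sub] at hlim
  refine tendsto_nhds_unique hL (hlim.congr' ?_)
  filter_upwards [eventually_ge_atTop (0 : ℝ)] with R hR0
  exact (integral_smul_eq_sub_integral_deriv_smul_primitive hF
    (fun x => ψ.differentiableAt.hasDerivAt)
    (SchwartzMap.derivCLM ℂ ℂ ψ).continuous (by linarith)).symm

/-- The reflected translate `s ↦ φ (t - s)` of a Schwartz function. -/
noncomputable def SchwartzMap.reflectTranslate (φ : SchwartzMap ℝ ℂ) (t : ℝ) :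
    SchwartzMap ℝ ℂ :=
  SchwartzMap.compCLMOfAntilipschitz (K := 1) ℂ (g := fun s : ℝ => t - s) (by fun_prop)
    (IsometryEquiv.subLeft t).isometry.antilipschitz φ

@[simp]
lemma SchwartzMap.reflectTranslate_apply (φ : SchwartzMap ℝ ℂ) (t s : ℝ) :
    φ.reflectTranslate t s = φ (t - s) := rfl

/-- If the convolution with `φ'` of a continuous function of linear growth vanishes, the
convolution with `φ` is constant. -/
lemma convS_eq_of_convS_deriv_eq_zero {X : Type*} [NormedAddCommGroup X] [NormedSpace ℂ X]
    [CompleteSpace X] {G : ℝ → X} (hG : Continuous G) {C : ℝ}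
    (hC0 : 0 ≤ C) (hC : ∀ s, ‖G s‖ ≤ C * (1 + |s|)) (φ : SchwartzMap ℝ ℂ)
    (h : ∀ u, convS (deriv φ) G u = 0) (t : ℝ) :
    convS φ G t = convS φ G 0 := by
  set φ' := SchwartzMap.derivCLM ℂ ℂ φ with hφ'
  obtain ⟨K, hK0, hK⟩ := φ'.exists_norm_mul_one_add_abs_pow_le
  have hdom : Integrable fun s : ℝ => K * (1 + |t|) ^ 3 * C * (1 + ‖s‖) ^ (-2 : ℝ) :=
    (integrable_one_add_norm (by simp)).const_mul _
  have hint : Integrable (Function.uncurry fun u s : ℝ => φ' (u - s) • G s)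
      ((volume.restrict (Set.uIoc 0 t)).prod volume) := by
    have hfin : Integrable (fun _ : ℝ => (1 : ℝ)) (volume.restrict (Set.uIoc 0 t)) :=
      (intervalIntegrable_const (a := 0) (b := t)).def'
    refine (hfin.mul_prod hdom).mono' (Continuous.aestronglyMeasurable ?_) ?_
    · exact (φ'.continuous.comp (continuous_fst.sub continuous_snd)).smul
        (hG.comp continuous_snd)
    · have hmem : ∀ᵐ p : ℝ × ℝ ∂((volume.restrict (Set.uIoc 0 t)).prod volume),
          p.1 ∈ Set.uIoc 0 t :=
        Measure.quasiMeasurePreserving_fst.ae (ae_restrict_mem measurableSet_uIoc)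
      filter_upwards [hmem] with ⟨u, s⟩ hu
      have hut : |u| ≤ |t| := by
        simpa using Set.abs_sub_left_of_mem_uIcc (Set.uIoc_subset_uIcc hu)
      have hs : (0 : ℝ) < 1 + |s| := by positivity
      have hst : 1 + |s| ≤ (1 + |u - s|) * (1 + |t|) := by
        have h1 : |s| ≤ |u - s| + |u| := by
          have := abs_sub_abs_le_abs_sub s u
          rw [abs_sub_comm s u] at this; linarith
        nlinarith [abs_nonneg (u - s), abs_nonneg t]
      simp only [Function.uncurry, one_mul, norm_smul, Real.norm_eq_abs]
      rw [Real.rpow_neg hs.le, ← div_eq_mul_inv, show (2 : ℝ) = ((2 : ℕ) : ℝ) by norm_num,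
        Real.rpow_natCast, le_div_iff₀ (by positivity)]
      calc ‖φ' (u - s)‖ * ‖G s‖ * (1 + |s|) ^ 2
          ≤ ‖φ' (u - s)‖ * (C * (1 + |s|)) * (1 + |s|) ^ 2 := by gcongr; exact hC s
        _ = C * (‖φ' (u - s)‖ * (1 + |s|) ^ 3) := by ring
        _ ≤ C * (‖φ' (u - s)‖ * ((1 + |u - s|) * (1 + |t|)) ^ 3) := by gcongr
        _ = C * (1 + |t|) ^ 3 * (‖φ' (u - s)‖ * (1 + |u - s|) ^ 3) := by ring
        _ ≤ C * (1 + |t|) ^ 3 * K := by gcongr; exact hK _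
        _ = _ := by ring
  have hswap := intervalIntegral_integral_swap hint
  have hl : ∀ u, ∫ s, φ' (u - s) • G s = 0 := h
  have hi : ∀ s, ∫ u in (0:ℝ)..t, φ' (u - s) • G s = φ (t - s) • G s - φ (0 - s) • G s := by
    intro s
    have hder : ∀ u ∈ Set.uIcc 0 t, HasDerivAt (fun u => φ (u - s)) (φ' (u - s)) u := fun u _ =>
      (φ.differentiableAt (x := u - s)).hasDerivAt.comp_sub_const u s
    rw [intervalIntegral.integral_smul_const,
      intervalIntegral.integral_eq_sub_of_hasDerivAt hder
        ((φ'.continuous.comp (continuous_id.sub continuous_const)).intervalIntegrable _ _),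
      sub_smul]
  simp only [hl, hi, intervalIntegral.integral_zero] at hswap
  have e := integral_sub ((φ.reflectTranslate t).integrable_smul_of_linear_growth hG hC)
    ((φ.reflectTranslate 0).integrable_smul_of_linear_growth hG hC)
  simp only [SchwartzMap.reflectTranslate_apply] at e
  rw [e] at hswap
  exact sub_eq_zero.1 hswap.symm

/-- If increments of `G` grow at most linearly, then `φ̂(0) G - G ∗ φ` is bounded. -/
lemma exists_norm_fourierInt_smul_sub_convS_le {X : Type*} [NormedAddCommGroup X]
    [NormedSpace ℂ X] [CompleteSpace X] {G : ℝ → X} (hG : Continuous G) {C : ℝ}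
    (hC : ∀ x y, ‖G x - G y‖ ≤ C * (1 + |x - y|)) (φ : SchwartzMap ℝ ℂ) :
    ∃ B : ℝ, ∀ t, ‖fourierInt φ 0 • G t - convS φ G t‖ ≤ B := by
  refine ⟨∫ x, C * (‖φ x‖ + ‖x‖ ^ 1 * ‖φ x‖), fun t => ?_⟩
  have hI : Integrable fun x => C * (‖φ x‖ + ‖x‖ ^ 1 * ‖φ x‖) :=
    (φ.integrable.norm.add (φ.integrable_pow_mul volume 1)).const_mul C
  have hconst : Integrable fun x => φ x • G t := φ.integrable.smul_const _
  have hbound : ∀ x, ‖φ x • (G t - G (t - x))‖ ≤ C * (‖φ x‖ + ‖x‖ ^ 1 * ‖φ x‖) := fun x => by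
    rw [norm_smul]
    calc ‖φ x‖ * ‖G t - G (t - x)‖ ≤ ‖φ x‖ * (C * (1 + |t - (t - x)|)) := by
          gcongr; exact hC _ _
      _ = _ := by rw [sub_sub_cancel, pow_one, Real.norm_eq_abs]; ring
  have hdiff : Integrable fun x => φ x • (G t - G (t - x)) :=
    hI.mono' (φ.continuous.smul (continuous_const.sub
      (hG.comp (continuous_const.sub continuous_id)))).aestronglyMeasurable (.of_forall hbound)
  have hconv : convS φ G t = ∫ x, φ x • G (t - x) := by
    rw [convS, ← integral_sub_left_eq_self (fun s => φ (t - s) • G s) volume t]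
    simp only [sub_sub_cancel]
  have heq : fourierInt φ 0 • G t - convS φ G t = ∫ x, φ x • (G t - G (t - x)) := by
    have h0 : fourierInt φ 0 • G t = ∫ x, φ x • G t := by
      rw [integral_smul_const]; simp [fourierInt]
    rw [hconv, h0, ← integral_sub hconst]
    · simp only [smul_sub]
    · refine (hconst.sub hdiff).congr (.of_forall fun x => ?_)
      simp [smul_sub]
  rw [heq]
  exact norm_integral_le_of_norm_le hI (.of_forall hbound)

/-- A function with bounded primitive is ergodic with mean `0`. -/
lemma ergodicWithMean_zero_of_bounded_primitive {X : Type*} [NormedAddCommGroup X]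
    [NormedSpace ℂ X] [CompleteSpace X] {F : ℝ → X} (hF : LocallyIntegrable F) {C : ℝ}
    (hC : ∀ t : ℝ, ‖∫ s in (0:ℝ)..t, F s‖ ≤ C) : ErgodicWithMean F 0 := by
  have hFi : ∀ x y, IntervalIntegrable F volume x y := fun x y =>
    (hF.integrableOn_isCompact isCompact_uIcc).intervalIntegrable
  have hC0 : 0 ≤ C := (norm_nonneg _).trans (hC 0)
  intro ε hε
  refine ⟨(2 * C + 1) / ε, by positivity, fun T hT t => ?_⟩
  have hT0 : 0 < T := lt_of_lt_of_le (by positivity) hT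
  rw [sub_zero, intervalIntegral.integral_comp_add_left,
    ← intervalIntegral.integral_interval_sub_left (hFi 0 _) (hFi 0 _), norm_smul, norm_inv,
    Real.norm_of_nonneg hT0.le, inv_mul_lt_iff₀ hT0]
  have h1 := norm_sub_le (∫ s in (0:ℝ)..(t + T), F s) (∫ s in (0:ℝ)..(t + 0), F s)
  have h2 := hC (t + T)
  have h3 := hC (t + 0)
  have h4 := (div_le_iff₀ hε).1 hT
  linarith

/-- If `F` is absolutely regular, `F∗φ = 0` for some Schwartz `φ` with
`φ̂(0) ≠ 0`, and the indefinite integral `PF` is uniformly continuous on ℝ, then `PF` is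
bounded and `F` is ergodic with mean `0`. -/
theorem indefInt_bounded_and_ergodic {X : Type*} [NormedAddCommGroup X] [NormedSpace ℂ X]
    [CompleteSpace X] (F : ℝ → X) (hF : AbsolutelyRegular F)
    (hreg : ∃ φ : SchwartzMap ℝ ℂ, fourierInt (⇑φ) 0 ≠ 0 ∧ ∀ t, convS (⇑φ) F t = 0)
    (hPF : UniformContinuous (fun t => ∫ s in (0:ℝ)..t, F s)) :
    (∃ C : ℝ, ∀ t : ℝ, ‖∫ s in (0:ℝ)..t, F s‖ ≤ C) ∧ ErgodicWithMean F 0 := by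
  obtain ⟨-, hloc, hint⟩ := hF
  obtain ⟨φ, hφ0, hφ⟩ := hreg
  obtain ⟨C, hC0, hC⟩ := hPF.exists_norm_sub_le_mul_one_add_abs
  have hG := hPF.continuous
  have hgrow : ∀ t, ‖∫ s in (0:ℝ)..t, F s‖ ≤ C * (1 + |t|) := fun t => by
    simpa using hC t 0
  have hderiv : ∀ u, convS (deriv φ) (fun t => ∫ s in (0:ℝ)..t, F s) u = 0 := fun u => by
    have h := SchwartzMap.integral_smul_eq_neg_integral_deriv_smul_primitive hloc hC0 hgrow
      (φ.reflectTranslate u) (hint _)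
    have hd : ∀ r, deriv (φ.reflectTranslate u) r = -deriv φ (u - r) := fun r =>
      ((φ.differentiableAt (x := u - r)).hasDerivAt.comp_const_sub u r).deriv
    have h0 : ∫ s, φ.reflectTranslate u s • F s = 0 := hφ u
    simp only [hd, h0, neg_smul, integral_neg, neg_neg] at h
    exact h.symm
  have hconst := convS_eq_of_convS_deriv_eq_zero hG hC0 hgrow φ hderiv
  obtain ⟨B, hB⟩ := exists_norm_fourierInt_smul_sub_convS_le hG hC φ
  have hbdd : ∃ C : ℝ, ∀ t : ℝ, ‖∫ s in (0:ℝ)..t, F s‖ ≤ C := by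
    set c := convS φ (fun t => ∫ s in (0:ℝ)..t, F s) 0
    refine ⟨(B + ‖c‖) / ‖fourierInt φ 0‖, fun t => ?_⟩
    rw [le_div_iff₀ (norm_pos_iff.2 hφ0), mul_comm, ← norm_smul]
    have h1 := hB t
    rw [hconst t] at h1
    linarith [norm_le_norm_sub_add (fourierInt φ 0 • ∫ s in (0:ℝ)..t, F s) c]
  obtain ⟨B', hB'⟩ := hbdd
  exact ⟨⟨B', hB'⟩, ergodicWithMean_zero_of_bounded_primitive hloc hB'⟩
end

section
/- Let X be a complex Banach space and let F : ℝ → X be absolutely regular and uniformly continuous. Suppose that for every ω ∈ ℝ there exists a Schwartz function φ with φ̂(ω) ≠ 0 such that F∗φ ∈ C₀(ℝ,X). Then F ∈ C₀(ℝ,X). -/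
open MeasureTheory Filter Topology

/-- `F ∈ C₀(ℝ,X)`: continuous and `‖F(t)‖ → 0` as `|t| → ∞`. -/
def IsCZero {X : Type*} [NormedAddCommGroup X] (F : ℝ → X) : Prop :=
  Continuous F ∧ Tendsto (fun t => ‖F t‖) (cocompact ℝ) (𝓝 0)

open scoped FourierTransform

section Growth

variable {X : Type*} [NormedAddCommGroup X]

/-- A uniformly continuous function on the line is Lipschitz up to an arbitrarily small error. -/
theorem UniformContinuous.exists_norm_sub_le {F : ℝ → X} (hF : UniformContinuous F) {ε : ℝ}
    (hε : 0 < ε) : ∃ A, 0 ≤ A ∧ ∀ s t, ‖F s - F t‖ ≤ ε + A * |s - t| := by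
  obtain ⟨δ, hδ, h⟩ := Metric.uniformContinuous_iff.1 hF ε hε
  have step : ∀ n : ℕ, ∀ s t, |s - t| ≤ n * (δ / 2) → ‖F s - F t‖ ≤ n * ε := by
    intro n
    induction n with
    | zero =>
      intro s t hst
      have : s = t := by
        have : s - t = 0 := by simpa using hst
        linarith
      simp [this]
    | succ n ih =>
      intro s t hst
      set r := s + (t - s) / (n + 1) with hr
      have hn : (0 : ℝ) < n + 1 := by positivity
      push_cast at hst
      have h1 : |s - r| < δ := by
        have : s - r = (s - t) / (n + 1) := by rw [hr]; ring
        rw [this, abs_div, abs_of_pos hn, div_lt_iff₀ hn]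
        nlinarith
      have h2 : |r - t| ≤ n * (δ / 2) := by
        have : r - t = (s - t) * (n / (n + 1)) := by rw [hr]; field_simp; ring
        rw [this, abs_mul, abs_of_nonneg (by positivity : (0 : ℝ) ≤ n / (n + 1))]
        calc |s - t| * (n / (n + 1)) ≤ (n + 1) * (δ / 2) * (n / (n + 1)) := by gcongr
          _ = n * (δ / 2) := by field_simp
      have h3 := (h (a := s) (b := r) (by rwa [Real.dist_eq])).le
      rw [dist_eq_norm] at h3
      have h4 := norm_add_le (F s - F r) (F r - F t)
      rw [sub_add_sub_cancel] at h4
      push_cast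
      linarith [ih r t h2]
  refine ⟨ε / (δ / 2), by positivity, fun s t ↦ ?_⟩
  have h1 : |s - t| / (δ / 2) ≤ ⌈|s - t| / (δ / 2)⌉₊ := Nat.le_ceil _
  have h2 := (Nat.ceil_lt_add_one (by positivity : 0 ≤ |s - t| / (δ / 2))).le
  refine (step _ s t ((div_le_iff₀ (by positivity)).1 h1)).trans ?_
  calc _ ≤ (|s - t| / (δ / 2) + 1) * ε := by gcongr
    _ = _ := by ring

theorem UniformContinuous.exists_norm_le_mul_one_add_abs {F : ℝ → X} (hF : UniformContinuous F) :
    ∃ A, 0 ≤ A ∧ ∀ s, ‖F s‖ ≤ A * (1 + |s|) := by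
  obtain ⟨A, hA, h⟩ := hF.exists_norm_sub_le one_pos
  refine ⟨‖F 0‖ + 1 + A, by positivity, fun s ↦ ?_⟩
  have h1 := h s 0
  have h2 := norm_le_norm_add_norm_sub' (F s) (F 0)
  rw [sub_zero] at h1
  nlinarith [abs_nonneg s, norm_nonneg (F 0)]

end Growth

theorem SchwartzMap.integrable_one_add_abs_mul_norm (φ : SchwartzMap ℝ ℂ) :
    Integrable fun u ↦ (1 + |u|) * ‖φ u‖ := by
  have h := φ.integrable.norm.add (φ.integrable_pow_mul volume 1)
  refine h.congr (.of_forall fun u ↦ ?_)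
  simp [add_mul]

section Conv

variable {X : Type*} [NormedAddCommGroup X] [NormedSpace ℂ X] {F : ℝ → X}

theorem one_add_abs_le_mul (t s : ℝ) : 1 + |s| ≤ (1 + |t|) * (1 + |t - s|) := by
  have : |s| ≤ |t| + |t - s| := by
    simpa using abs_sub t (t - s)
  nlinarith [abs_nonneg t, abs_nonneg (t - s)]

/-- The integrand of `convS φ F` is integrable for `F` of linear growth. -/
theorem integrable_convS {A : ℝ} (hA : 0 ≤ A) (hFc : Continuous F)
    (hFA : ∀ s, ‖F s‖ ≤ A * (1 + |s|)) (φ : SchwartzMap ℝ ℂ) (t : ℝ) :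
    Integrable fun s ↦ φ (t - s) • F s := by
  have hm : Continuous fun s ↦ φ (t - s) • F s := (φ.continuous.comp (by fun_prop)).smul hFc
  refine ((φ.integrable_one_add_abs_mul_norm.comp_sub_left t).const_mul (A * (1 + |t|))).mono'
    hm.aestronglyMeasurable (.of_forall fun s ↦ ?_)
  rw [norm_smul]
  calc ‖φ (t - s)‖ * ‖F s‖ ≤ ‖φ (t - s)‖ * (A * ((1 + |t|) * (1 + |t - s|))) := by
        gcongr
        exact (hFA s).trans (by gcongr; exact one_add_abs_le_mul t s)
    _ = _ := by ring

/-- Associativity of convolution, for `F` of linear growth. -/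
theorem convS_convolution [CompleteSpace X] {A : ℝ} (hA : 0 ≤ A) (hFc : Continuous F)
    (hFA : ∀ s, ‖F s‖ ≤ A * (1 + |s|)) (g φ : SchwartzMap ℝ ℂ) (t : ℝ) :
    convS (SchwartzMap.convolution (ContinuousLinearMap.mul ℂ ℂ) g φ) F t =
      ∫ u, g u • convS φ F (t - u) := by
  have hint : Integrable (fun p : ℝ × ℝ ↦ (g p.2 * φ (t - p.1 - p.2)) • F p.1)
      (volume.prod volume) := by
    have h0 := (g.integrable_one_add_abs_mul_norm.convolution_integrand
      (ContinuousLinearMap.mul ℝ ℝ) φ.integrable_one_add_abs_mul_norm (μ := volume))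
    have hmp : MeasurePreserving (fun p : ℝ × ℝ ↦ (t - p.1, p.2))
        (volume.prod volume) (volume.prod volume) :=
      (volume.measurePreserving_sub_left t).prod (MeasurePreserving.id _)
    have h1 := (hmp.integrable_comp_of_integrable h0).const_mul (A * (1 + |t|))
    have hm : Continuous fun p : ℝ × ℝ ↦ (g p.2 * φ (t - p.1 - p.2)) • F p.1 :=
      ((g.continuous.comp (by fun_prop)).mul (φ.continuous.comp (by fun_prop))).smul
        (hFc.comp (by fun_prop))
    refine h1.mono' hm.aestronglyMeasurable (.of_forall fun ⟨s, u⟩ ↦ ?_)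
    simp only [Function.comp, ContinuousLinearMap.mul_apply', norm_smul, norm_mul]
    have hs : 1 + |s| ≤ (1 + |t|) * ((1 + |u|) * (1 + |t - s - u|)) := by
      refine (one_add_abs_le_mul t s).trans ?_
      gcongr
      have h2 := one_add_abs_le_mul u (t - s)
      rwa [abs_sub_comm u] at h2
    calc ‖g u‖ * ‖φ (t - s - u)‖ * ‖F s‖
        ≤ ‖g u‖ * ‖φ (t - s - u)‖ * (A * ((1 + |t|) * ((1 + |u|) * (1 + |t - s - u|)))) := by
          gcongr
          exact (hFA s).trans (by gcongr)
      _ = _ := by ring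
  calc convS (SchwartzMap.convolution (ContinuousLinearMap.mul ℂ ℂ) g φ) F t
      = ∫ s, ∫ u, (g u * φ (t - s - u)) • F s := by
        refine integral_congr_ae (.of_forall fun s ↦ ?_)
        simp only [SchwartzMap.convolution_apply, integral_smul_const]
        rfl
    _ = ∫ u, ∫ s, (g u * φ (t - s - u)) • F s := integral_integral_swap hint
    _ = _ := by
        refine integral_congr_ae (.of_forall fun u ↦ ?_)
        simp only [convS, mul_smul, integral_smul, sub_right_comm t]

theorem convS_add {A : ℝ} (hA : 0 ≤ A) (hFc : Continuous F)
    (hFA : ∀ s, ‖F s‖ ≤ A * (1 + |s|)) (φ ψ : SchwartzMap ℝ ℂ) (t : ℝ) :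
    convS (φ + ψ : SchwartzMap ℝ ℂ) F t = convS φ F t + convS ψ F t := by
  simp only [convS, add_apply, add_smul]
  exact integral_add (integrable_convS hA hFc hFA φ t) (integrable_convS hA hFc hFA ψ t)

end Conv

section CZero

variable {X : Type*} [NormedAddCommGroup X]

theorem IsCZero.add {F G : ℝ → X} (hF : IsCZero F) (hG : IsCZero G) :
    IsCZero fun t ↦ F t + G t :=
  ⟨hF.1.add hG.1, squeeze_zero (fun _ ↦ norm_nonneg _) (fun _ ↦ norm_add_le _ _)
    (by simpa using hF.2.add hG.2)⟩

theorem IsCZero.exists_norm_le {F : ℝ → X} (hF : IsCZero F) : ∃ C, ∀ t, ‖F t‖ ≤ C := by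
  let f : ZeroAtInftyContinuousMap ℝ X :=
    ⟨⟨F, hF.1⟩, tendsto_zero_iff_norm_tendsto_zero.2 hF.2⟩
  exact ⟨‖f.toBCF‖, f.toBCF.norm_coe_le_norm⟩

/-- Convolution with an integrable function preserves `C₀`. -/
theorem IsCZero.integral_smul_comp_sub [NormedSpace ℂ X] {F : ℝ → X} (hF : IsCZero F)
    {g : ℝ → ℂ} (hg : Integrable g) : IsCZero fun t ↦ ∫ u, g u • F (t - u) := by
  obtain ⟨C, hC⟩ := hF.exists_norm_le
  have hm (t : ℝ) : AEStronglyMeasurable (fun u ↦ g u • F (t - u)) :=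
    hg.aestronglyMeasurable.smul (hF.1.comp (by fun_prop)).aestronglyMeasurable
  have hb (t u : ℝ) : ‖g u • F (t - u)‖ ≤ ‖g u‖ * C := by
    rw [norm_smul]
    gcongr
    exact hC _
  refine ⟨?_, ?_⟩
  · refine continuous_of_dominated hm (fun t ↦ .of_forall (hb t)) (hg.norm.mul_const C)
      (.of_forall fun u ↦ ?_)
    exact continuous_const.smul (hF.1.comp (by fun_prop))
  · have h0 : Tendsto F (cocompact ℝ) (𝓝 0) := tendsto_zero_iff_norm_tendsto_zero.2 hF.2
    have : (cocompact ℝ).IsCountablyGenerated := by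
      rw [cocompact_eq_atBot_atTop]
      infer_instance
    refine tendsto_zero_iff_norm_tendsto_zero.1 ?_
    rw [← integral_zero ℝ X (μ := volume)]
    refine tendsto_integral_filter_of_dominated_convergence (fun u ↦ ‖g u‖ * C)
      (.of_forall hm) (.of_forall fun t ↦ .of_forall (hb t)) (hg.norm.mul_const C)
      (.of_forall fun u ↦ ?_)
    have h1 : Tendsto (fun t : ℝ ↦ t - u) (cocompact ℝ) (cocompact ℝ) :=
      (Homeomorph.subRight u).isClosedEmbedding.tendsto_cocompact
    simpa using (h0.comp h1).const_smul (g u)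

/-- A uniform limit of `C₀` functions is `C₀`. -/
theorem IsCZero.of_forall_exists_norm_sub_le {F : ℝ → X} (hF : Continuous F)
    (h : ∀ ε > 0, ∃ G, IsCZero G ∧ ∀ t, ‖G t - F t‖ ≤ ε) : IsCZero F := by
  refine ⟨hF, ?_⟩
  rw [Metric.tendsto_nhds]
  intro ε hε
  obtain ⟨G, hG, hGF⟩ := h (ε / 2) (by positivity)
  filter_upwards [Metric.tendsto_nhds.1 hG.2 (ε / 2) (by positivity)] with t ht
  simp only [dist_zero_right, norm_norm] at ht ⊢
  have := norm_le_norm_add_norm_sub (G t) (F t)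
  linarith [hGF t]

end CZero

open scoped ComplexConjugate ComplexOrder

theorem fourierInt_eq_fourier_s13 (φ : SchwartzMap ℝ ℂ) (ω : ℝ) :
    fourierInt φ ω = 𝓕 φ (ω / (2 * Real.pi)) := by
  rw [SchwartzMap.fourier_coe, Real.fourier_real_eq_integral_exp_smul, fourierInt]
  refine integral_congr_ae (.of_forall fun t ↦ ?_)
  simp only [smul_eq_mul]
  congr 2
  push_cast
  have : (Real.pi : ℂ) ≠ 0 := by exact_mod_cast Real.pi_ne_zero
  field_simp

theorem SchwartzMap.fourier_convolution_mul_apply (g φ : SchwartzMap ℝ ℂ) (x : ℝ) :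
    𝓕 (SchwartzMap.convolution (ContinuousLinearMap.mul ℂ ℂ) g φ) x = 𝓕 g x * 𝓕 φ x := by
  rw [SchwartzMap.fourier_convolution, SchwartzMap.pairing_apply_apply]
  rfl

section Ideal

variable {X : Type*} [NormedAddCommGroup X] [NormedSpace ℂ X] [CompleteSpace X] {F : ℝ → X}

theorem IsCZero.convS_convolution (hF : UniformContinuous F) {φ : SchwartzMap ℝ ℂ}
    (hφ : IsCZero (convS φ F)) (g : SchwartzMap ℝ ℂ) :
    IsCZero (convS (SchwartzMap.convolution (ContinuousLinearMap.mul ℂ ℂ) g φ) F) := by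
  obtain ⟨A, hA, hFA⟩ := hF.exists_norm_le_mul_one_add_abs
  rw [funext (_root_.convS_convolution hA hF.continuous hFA g φ)]
  exact hφ.integral_smul_comp_sub g.integrable

/-- Over a compact set of frequencies the local conditions can be met by one Schwartz function
with nonnegative Fourier transform. -/
theorem exists_isCZero_convS_fourier_ne_zero (hF : UniformContinuous F)
    (h : ∀ x : ℝ, ∃ φ : SchwartzMap ℝ ℂ, 𝓕 φ x ≠ 0 ∧ IsCZero (convS φ F))
    {K : Set ℝ} (hK : IsCompact K) :
    ∃ φ : SchwartzMap ℝ ℂ, IsCZero (convS φ F) ∧ (∀ x, 0 ≤ 𝓕 φ x) ∧ ∀ x ∈ K, 𝓕 φ x ≠ 0 := by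
  obtain ⟨A, hA, hFA⟩ := hF.exists_norm_le_mul_one_add_abs
  refine hK.induction_on (p := fun K ↦ ∃ φ : SchwartzMap ℝ ℂ, IsCZero (convS φ F) ∧
    (∀ x, 0 ≤ 𝓕 φ x) ∧ ∀ x ∈ K, 𝓕 φ x ≠ 0) ?_ ?_ ?_ ?_
  · refine ⟨0, ?_, fun x ↦ ?_, by simp⟩
    · rw [show convS (0 : SchwartzMap ℝ ℂ) F = fun _ ↦ 0 from funext fun t ↦ by simp [convS]]
      exact ⟨continuous_const, by simp⟩
    · rw [FourierTransform.fourier_zero]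
      simp
  · rintro s t hst ⟨φ, h1, h2, h3⟩
    exact ⟨φ, h1, h2, fun x hx ↦ h3 x (hst hx)⟩
  · rintro s t ⟨φ, h1, h2, h3⟩ ⟨ψ, k1, k2, k3⟩
    have hadd (x : ℝ) : 𝓕 (φ + ψ) x = 𝓕 φ x + 𝓕 ψ x := by
      rw [FourierTransform.fourier_add, add_apply]
    refine ⟨φ + ψ, ?_, fun x ↦ ?_, fun x hx h0 ↦ ?_⟩
    · rw [funext (convS_add hA hF.continuous hFA φ ψ)]
      exact h1.add k1
    · rw [hadd]
      exact add_nonneg (h2 x) (k2 x)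
    · rw [hadd, add_eq_zero_iff_of_nonneg (h2 x) (k2 x)] at h0
      exact hx.elim (fun hx ↦ h3 x hx h0.1) (fun hx ↦ k3 x hx h0.2)
  · intro x hx
    obtain ⟨φ, hφx, hφ⟩ := h x
    let c : SchwartzMap ℝ ℂ := (𝓕 φ).postcompCLM (Complex.conjCLE : ℂ →L[ℝ] ℂ)
    have hc (y : ℝ) : 𝓕 (SchwartzMap.convolution (ContinuousLinearMap.mul ℂ ℂ) (𝓕⁻ c) φ) y =
        conj (𝓕 φ y) * 𝓕 φ y := by
      rw [SchwartzMap.fourier_convolution_mul_apply, FourierTransform.fourier_fourierInv_eq]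
      rfl
    refine ⟨{y | 𝓕 φ y ≠ 0}, mem_nhdsWithin_of_mem_nhds
      ((isOpen_ne_fun (𝓕 φ).continuous continuous_const).mem_nhds hφx),
      _, hφ.convS_convolution hF (𝓕⁻ c), fun y ↦ ?_, fun y hy ↦ ?_⟩
    · rw [hc]
      exact star_mul_self_nonneg _
    · rw [hc]
      exact mul_ne_zero (by simpa using hy) hy

/-- If the local conditions hold, every band-limited Schwartz function convolves `F` into `C₀`. -/
theorem isCZero_convS_of_hasCompactSupport_fourier (hF : UniformContinuous F)
    (h : ∀ x : ℝ, ∃ φ : SchwartzMap ℝ ℂ, 𝓕 φ x ≠ 0 ∧ IsCZero (convS φ F))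
    {ψ : SchwartzMap ℝ ℂ} (hψ : HasCompactSupport (𝓕 ψ : SchwartzMap ℝ ℂ)) :
    IsCZero (convS ψ F) := by
  obtain ⟨φ, hφ, -, hne⟩ := exists_isCZero_convS_fourier_ne_zero hF h hψ.isCompact
  have hsm : ContDiff ℝ (⊤ : ℕ∞) fun x ↦ 𝓕 ψ x * (𝓕 φ x)⁻¹ := by
    refine contDiff_iff_contDiffAt.2 fun x ↦ ?_
    by_cases hx : x ∈ tsupport (𝓕 ψ : SchwartzMap ℝ ℂ)
    · exact (𝓕 ψ).smooth'.contDiffAt.mul ((𝓕 φ).smooth'.contDiffAt.inv (hne x hx))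
    · have : (fun x ↦ 𝓕 ψ x * (𝓕 φ x)⁻¹) =ᶠ[𝓝 x] fun _ ↦ 0 := by
        filter_upwards [notMem_tsupport_iff_eventuallyEq.1 hx] with y hy
        simp [hy]
      exact contDiffAt_const.congr_of_eventuallyEq this
  let g : SchwartzMap ℝ ℂ := HasCompactSupport.toSchwartzMap (hψ.mul_right) hsm
  have : ψ = SchwartzMap.convolution (ContinuousLinearMap.mul ℂ ℂ) (𝓕⁻ g) φ := by
    refine (FourierTransform.fourierEquiv ℂ (SchwartzMap ℝ ℂ)).injective ?_
    ext x
    simp only [FourierTransform.fourierEquiv_apply]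
    rw [SchwartzMap.fourier_convolution_mul_apply, FourierTransform.fourier_fourierInv_eq]
    change 𝓕 ψ x = 𝓕 ψ x * (𝓕 φ x)⁻¹ * 𝓕 φ x
    by_cases hx : x ∈ tsupport (𝓕 ψ : SchwartzMap ℝ ℂ)
    · rw [inv_mul_cancel_right₀ (hne x hx)]
    · simp [image_eq_zero_of_notMem_tsupport hx]
  rw [this]
  exact hφ.convS_convolution hF _

end Ideal

section ApproximateIdentity

/-- There is a band-limited Schwartz function with integral one. -/
theorem exists_hasCompactSupport_fourier_integral_eq_one :
    ∃ ψ : SchwartzMap ℝ ℂ, HasCompactSupport (𝓕 ψ : SchwartzMap ℝ ℂ) ∧ ∫ t, ψ t = 1 := by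
  let b : ContDiffBump (0 : ℝ) := ⟨1, 2, one_pos, one_lt_two⟩
  have hb : HasCompactSupport fun x ↦ (b x : ℂ) :=
    b.hasCompactSupport.comp_left (g := ((↑) : ℝ → ℂ)) (by simp)
  let χ : SchwartzMap ℝ ℂ :=
    hb.toSchwartzMap (Complex.ofRealCLM.contDiff.comp b.contDiff)
  refine ⟨𝓕⁻ χ, ?_, ?_⟩
  · rw [FourierTransform.fourier_fourierInv_eq]
    exact hb
  · have h1 : 𝓕 (𝓕⁻ χ) 0 = 1 := by
      rw [FourierTransform.fourier_fourierInv_eq]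
      change ((b 0 : ℝ) : ℂ) = 1
      simp [b.one_of_mem_closedBall (Metric.mem_closedBall_self b.rIn_pos.le)]
    rw [SchwartzMap.fourier_coe, Real.fourier_real_eq_integral_exp_smul] at h1
    simpa using h1

/-- The rescaling `t ↦ c ψ(c t)` of a Schwartz function. -/
noncomputable def SchwartzMap.dilate (ψ : SchwartzMap ℝ ℂ) {c : ℝ} (hc : c ≠ 0) :
    SchwartzMap ℝ ℂ :=
  c • SchwartzMap.compCLMOfContinuousLinearEquiv ℝ
    (ContinuousLinearEquiv.smulLeft (Units.mk0 c hc)) ψ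

theorem SchwartzMap.dilate_apply (ψ : SchwartzMap ℝ ℂ) {c : ℝ} (hc : c ≠ 0) (t : ℝ) :
    ψ.dilate hc t = c • ψ (c * t) := rfl

theorem SchwartzMap.fourier_dilate_apply (ψ : SchwartzMap ℝ ℂ) {c : ℝ} (hc : 0 < c) (x : ℝ) :
    𝓕 (ψ.dilate hc.ne') x = 𝓕 ψ (c⁻¹ * x) := by
  simp only [SchwartzMap.fourier_coe, Real.fourier_real_eq_integral_exp_smul]
  have h := Measure.integral_comp_mul_left
    (fun v : ℝ ↦ Complex.exp (↑(-2 * Real.pi * v * (c⁻¹ * x)) * Complex.I) • ψ v) c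
  rw [abs_of_pos (inv_pos.2 hc), eq_inv_smul_iff₀ hc.ne', ← integral_smul] at h
  rw [← h]
  refine integral_congr_ae (.of_forall fun t ↦ ?_)
  simp only [dilate_apply]
  rw [smul_comm c]
  have : -2 * Real.pi * (c * t) * (c⁻¹ * x) = -2 * Real.pi * t * x := by field_simp
  rw [this]

theorem SchwartzMap.hasCompactSupport_fourier_dilate {ψ : SchwartzMap ℝ ℂ}
    (hψ : HasCompactSupport (𝓕 ψ : SchwartzMap ℝ ℂ)) {c : ℝ} (hc : 0 < c) :
    HasCompactSupport (𝓕 (ψ.dilate hc.ne') : SchwartzMap ℝ ℂ) := by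
  have h := hψ.comp_homeomorph (Homeomorph.mulLeft₀ c⁻¹ (inv_ne_zero hc.ne'))
  convert h using 1
  exact funext (ψ.fourier_dilate_apply hc)

variable {X : Type*} [NormedAddCommGroup X] [NormedSpace ℂ X] [CompleteSpace X] {F : ℝ → X}

/-- Quantitative approximate identity for functions that are Lipschitz up to an error. -/
theorem norm_convS_dilate_sub_le {A B ε : ℝ} (hB : 0 ≤ B) (hFc : Continuous F)
    (hFB : ∀ s, ‖F s‖ ≤ B * (1 + |s|))
    (hFA : ∀ s t, ‖F s - F t‖ ≤ ε + A * |s - t|) {ψ : SchwartzMap ℝ ℂ} (hψ : ∫ t, ψ t = 1)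
    {c : ℝ} (hc : 0 < c) (t : ℝ) :
    ‖convS (ψ.dilate hc.ne') F t - F t‖ ≤
      ε * (∫ v, ‖ψ v‖) + c⁻¹ * (A * ∫ v, |v| * ‖ψ v‖) := by
  have hsub {Y : Type _} [NormedAddCommGroup Y] [NormedSpace ℝ Y] (f : ℝ → Y) :
      ∫ s, c • f (c * (t - s)) = ∫ v, f v := by
    rw [integral_sub_left_eq_self (fun s ↦ c • f (c * s)) volume t, integral_smul,
      Measure.integral_comp_mul_left, abs_of_pos (inv_pos.2 hc), smul_inv_smul₀ hc.ne']
  have hone : ∫ s, ψ.dilate hc.ne' (t - s) • F t = F t := by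
    rw [integral_smul_const]
    simp only [SchwartzMap.dilate_apply]
    rw [hsub ψ, hψ, one_smul]
  have hi0 : Integrable fun v ↦ ‖ψ v‖ := ψ.integrable.norm
  have hi1 : Integrable fun v ↦ |v| * ‖ψ v‖ := by
    simpa using ψ.integrable_pow_mul volume 1
  have hbi : Integrable fun v ↦ ε * ‖ψ v‖ + c⁻¹ * (A * (|v| * ‖ψ v‖)) :=
    (hi0.const_mul ε).add ((hi1.const_mul A).const_mul _)
  have hbi' : Integrable fun s ↦ c • (ε * ‖ψ (c * (t - s))‖ +
      c⁻¹ * (A * (|c * (t - s)| * ‖ψ (c * (t - s))‖))) :=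
    ((hbi.comp_mul_left' hc.ne').comp_sub_left t).smul c
  calc ‖convS (ψ.dilate hc.ne') F t - F t‖
      = ‖∫ s, ψ.dilate hc.ne' (t - s) • (F s - F t)‖ := by
        conv_lhs => rw [← hone]
        simp only [smul_sub]
        rw [integral_sub (integrable_convS hB hFc hFB _ t)
          (((ψ.dilate hc.ne').integrable.comp_sub_left t).smul_const _), convS, hone]
    _ ≤ ∫ s, c • (ε * ‖ψ (c * (t - s))‖ +
          c⁻¹ * (A * (|c * (t - s)| * ‖ψ (c * (t - s))‖))) := by
        refine norm_integral_le_of_norm_le hbi' (.of_forall fun s ↦ ?_)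
        rw [SchwartzMap.dilate_apply, norm_smul, norm_smul, Real.norm_of_nonneg hc.le, abs_mul,
          abs_of_pos hc]
        calc c * ‖ψ (c * (t - s))‖ * ‖F s - F t‖
            ≤ c * ‖ψ (c * (t - s))‖ * (ε + A * |s - t|) := by gcongr; exact hFA s t
          _ = _ := by
            rw [abs_sub_comm s t, smul_eq_mul]
            field_simp
    _ = ∫ v, (ε * ‖ψ v‖ + c⁻¹ * (A * (|v| * ‖ψ v‖))) :=
        hsub fun v ↦ ε * ‖ψ v‖ + c⁻¹ * (A * (|v| * ‖ψ v‖))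
    _ = _ := by
        rw [integral_add (hi0.const_mul ε) ((hi1.const_mul A).const_mul _)]
        simp only [integral_const_mul]

end ApproximateIdentity

/-- If `F` is absolutely regular, uniformly continuous, and every `ω ∈ ℝ`
admits a Schwartz `φ` with `φ̂(ω) ≠ 0` and `F∗φ ∈ C₀(ℝ,X)`, then `F ∈ C₀(ℝ,X)`. -/
theorem mem_C0_of_empty_C0_spectrum {X : Type*} [NormedAddCommGroup X] [NormedSpace ℂ X]
    [CompleteSpace X] (F : ℝ → X) (hF : AbsolutelyRegular F) (hUC : UniformContinuous F)
    (hsp : ∀ ω : ℝ, ∃ φ : SchwartzMap ℝ ℂ,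
      fourierInt (⇑φ) ω ≠ 0 ∧ IsCZero (fun t => convS (⇑φ) F t)) :
    IsCZero F := by
  have h (x : ℝ) : ∃ φ : SchwartzMap ℝ ℂ, 𝓕 φ x ≠ 0 ∧ IsCZero (convS φ F) := by
    obtain ⟨φ, h1, h2⟩ := hsp (x * (2 * Real.pi))
    rw [fourierInt_eq_fourier_s13, mul_div_cancel_right₀ _ (by positivity)] at h1
    exact ⟨φ, h1, h2⟩
  obtain ⟨ψ, hψc, hψ⟩ := exists_hasCompactSupport_fourier_integral_eq_one
  obtain ⟨B, hB, hFB⟩ := hUC.exists_norm_le_mul_one_add_abs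
  refine IsCZero.of_forall_exists_norm_sub_le hUC.continuous fun ε hε ↦ ?_
  set M := ∫ v, ‖ψ v‖ with hM
  have hM0 : 0 ≤ M := integral_nonneg fun _ ↦ norm_nonneg _
  obtain ⟨A, hA, hFA⟩ := hUC.exists_norm_sub_le (ε := ε / 2 / (M + 1)) (by positivity)
  set N := A * ∫ v, |v| * ‖ψ v‖ with hN
  have hN0 : 0 ≤ N := mul_nonneg hA (integral_nonneg fun _ ↦ by positivity)
  have hc : 0 < (N + 1) / (ε / 2) := by positivity
  refine ⟨_, isCZero_convS_of_hasCompactSupport_fourier hUC h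
    (SchwartzMap.hasCompactSupport_fourier_dilate hψc hc), fun t ↦
    (norm_convS_dilate_sub_le hB hUC.continuous hFB hFA hψ hc t).trans ?_⟩
  rw [← hM, ← hN, inv_div]
  have h1 : ε / 2 / (M + 1) * M ≤ ε / 2 := by
    rw [div_mul_eq_mul_div, div_le_iff₀ (by positivity)]
    nlinarith
  have h2 : ε / 2 / (N + 1) * N ≤ ε / 2 := by
    rw [div_mul_eq_mul_div, div_le_iff₀ (by positivity)]
    nlinarith
  linarith
end

section
/- Let X be a complex Banach space and let F : ℝ → X be strongly measurable and locally Bochner integrable. Suppose that for every ω ∈ ℝ there exists a smooth compactly supported φ : ℝ → ℂ with φ̂(ω) ≠ 0 such that F∗φ ∈ C₀(ℝ,X). If ψ : ℝ → ℂ is smooth and compactly supported and F∗ψ is uniformly continuous, then F∗ψ ∈ C₀(ℝ,X). -/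
open MeasureTheory Filter Topology

open ContinuousLinearMap Convolution FourierTransform SchwartzMap

/-- Convolving an integrable function with a function vanishing at infinity gives a function
vanishing at infinity. -/
theorem Continuous.tendsto_convolution_cocompact {X : Type*} [NormedAddCommGroup X]
    [NormedSpace ℂ X] {f : ℝ → ℂ} {g : ℝ → X} (hf : Integrable f) (hg : Continuous g)
    (hg0 : Tendsto g (cocompact ℝ) (𝓝 0)) :
    Tendsto (f ⋆[lsmul ℂ ℂ] g) (cocompact ℝ) (𝓝 0) := by
  obtain ⟨C, hC⟩ := ZeroAtInftyContinuousMap.bounded (⟨⟨g, hg⟩, hg0⟩ : ZeroAtInftyContinuousMap ℝ X)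
  have hbd : ∀ t, ‖g t‖ ≤ C + ‖g 0‖ := fun t => by
    have h : dist (g t) (g 0) ≤ C := hC t 0
    rw [dist_eq_norm] at h
    linarith [norm_le_norm_sub_add (g t) (g 0)]
  have : (cocompact ℝ).IsCountablyGenerated := by
    rw [cocompact_eq_atBot_atTop]; infer_instance
  have key : Tendsto (fun t => ∫ s, f s • g (t - s)) (cocompact ℝ) (𝓝 (∫ _ : ℝ, (0 : X))) := by
    refine tendsto_integral_filter_of_dominated_convergence (fun s => ‖f s‖ * (C + ‖g 0‖))
      (Eventually.of_forall fun t => ?_) (Eventually.of_forall fun t => ?_)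
      (hf.norm.mul_const _) (Eventually.of_forall fun s => ?_)
    · exact hf.aestronglyMeasurable.smul
        (hg.comp (continuous_const.sub continuous_id)).aestronglyMeasurable
    · refine Eventually.of_forall fun s => ?_
      rw [norm_smul]
      gcongr
      exact hbd _
    · have h := (hg0.comp (Homeomorph.subRight s).isClosedEmbedding.tendsto_cocompact).const_smul
        (f s)
      rw [smul_zero] at h
      exact h
  rw [integral_zero] at key
  exact key

/-- The increments of a uniformly continuous function on `ℝ` grow at most linearly, with an
arbitrarily small constant term. -/
theorem UniformContinuous.norm_sub_le_add_mul_abs {X : Type*} [NormedAddCommGroup X] {g : ℝ → X}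
    (hg : UniformContinuous g) {ε : ℝ} (hε : 0 < ε) :
    ∃ C : ℝ, 0 ≤ C ∧ ∀ s t, ‖g (t - s) - g t‖ ≤ ε + C * |s| := by
  obtain ⟨δ, hδ, h⟩ := Metric.uniformContinuous_iff.1 hg ε hε
  have step : ∀ n : ℕ, ∀ s t : ℝ, |s| < n * δ → ‖g (t - s) - g t‖ ≤ n * ε := by
    intro n
    induction n with
    | zero => intro s t hs; simp at hs; linarith [abs_nonneg s]
    | succ n ih =>
      intro s t hs
      push_cast at hs ⊢
      have hn : (0 : ℝ) < n + 1 := by positivity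
      rcases Nat.eq_zero_or_pos n with rfl | hn0
      · have := h (a := t - s) (b := t) (by simpa [Real.dist_eq] using hs)
        rw [dist_eq_norm] at this
        simpa using this.le
      have hn0' : (0 : ℝ) < n := by exact_mod_cast hn0
      have hfrac : |s| / (n + 1) < δ := by rw [div_lt_iff₀ hn]; linarith
      have h1 := ih (n * s / (n + 1)) t (by
        rw [abs_div, abs_mul, abs_of_pos hn, abs_of_pos hn0', mul_div_assoc]
        gcongr)
      have h2 := h (a := t - s) (b := t - n * s / (n + 1)) (by
        rw [Real.dist_eq, show t - s - (t - n * s / (n + 1)) = -(s / (n + 1)) by field_simp; ring,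
          abs_neg, abs_div, abs_of_pos hn]
        exact hfrac)
      rw [dist_eq_norm] at h2
      linarith [norm_sub_le_norm_sub_add_norm_sub (g (t - s)) (g (t - n * s / (n + 1))) (g t)]
  refine ⟨ε / δ, by positivity, fun s t => ?_⟩
  have hlt := Nat.lt_floor_add_one (|s| / δ)
  have hle := Nat.floor_le (show 0 ≤ |s| / δ by positivity)
  refine (step (⌊|s| / δ⌋₊ + 1) s t ?_).trans ?_
  · push_cast
    rwa [div_lt_iff₀ hδ] at hlt
  · push_cast
    rw [div_mul_eq_mul_div, ← mul_div_assoc']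
    nlinarith

/-- The convolution of a function with finite first moment and a continuous function of linear
growth exists. -/
theorem convolutionExistsAt_of_linear_growth {𝕜 E E' F : Type*} [NontriviallyNormedField 𝕜]
    [NormedAddCommGroup E] [NormedAddCommGroup E'] [NormedAddCommGroup F]
    [NormedSpace 𝕜 E] [NormedSpace 𝕜 E'] [NormedSpace 𝕜 F] (L : E →L[𝕜] E' →L[𝕜] F)
    {f : ℝ → E} {g : ℝ → E'} (hf : Integrable f) (hf1 : Integrable fun s => |s| * ‖f s‖)
    (hg : Continuous g) {A C : ℝ} (hgr : ∀ s t, ‖g (t - s) - g t‖ ≤ A + C * |s|) (x : ℝ) :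
    ConvolutionExistsAt f g x L := by
  refine Integrable.mono' (g := fun s => ‖L‖ * ((‖g x‖ + A) * ‖f s‖ + C * (|s| * ‖f s‖)))
    (((hf.norm.const_mul _).add (hf1.const_mul _)).const_mul _) ?_ (Eventually.of_forall fun s => ?_)
  · exact L.aestronglyMeasurable_comp₂ hf.aestronglyMeasurable
      (hg.comp (continuous_const.sub continuous_id)).aestronglyMeasurable
  · have h1 : ‖g (x - s)‖ ≤ ‖g x‖ + A + C * |s| := by
      linarith [hgr s x, norm_le_norm_sub_add (g (x - s)) (g x)]
    calc ‖L (f s) (g (x - s))‖ ≤ ‖L‖ * ‖f s‖ * ‖g (x - s)‖ := L.le_opNorm₂ _ _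
      _ ≤ ‖L‖ * ‖f s‖ * (‖g x‖ + A + C * |s|) := by gcongr
      _ = _ := by ring

theorem SchwartzMap.integrable_abs_mul_norm (f : 𝓢(ℝ, ℂ)) :
    Integrable fun s => |s| * ‖f s‖ := by
  simpa using f.integrable_pow_mul volume 1

section

variable {X : Type*} [NormedAddCommGroup X] [NormedSpace ℂ X] [CompleteSpace X]

/-- Associativity of the convolution of two Schwartz functions, one of them compactly supported,
with a continuous function of linear growth. -/
theorem SchwartzMap.convolution_assoc_of_linear_growth (h φ : 𝓢(ℝ, ℂ)) (hφ : HasCompactSupport φ)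
    {g : ℝ → X} (hg : Continuous g) {A C : ℝ} (hgr : ∀ s t, ‖g (t - s) - g t‖ ≤ A + C * |s|)
    (x : ℝ) :
    ((h ⋆[lsmul ℂ ℂ] φ) ⋆[lsmul ℂ ℂ] g) x = (h ⋆[lsmul ℂ ℂ] (φ ⋆[lsmul ℂ ℂ] g)) x := by
  have hgr' : ∀ s t, ‖‖g (t - s)‖ - ‖g t‖‖ ≤ A + C * |s| := fun s t =>
    (abs_norm_sub_norm_le _ _).trans (hgr s t)
  have hex : ∀ x, ConvolutionExistsAt (fun x => ‖φ x‖) (fun x => ‖g x‖) x (mul ℝ ℝ) :=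
    convolutionExistsAt_of_linear_growth _ φ.integrable.norm
      (by simpa using φ.integrable_abs_mul_norm) hg.norm hgr'
  refine convolution_assoc _ _ _ _ mul_smul h.continuous.aestronglyMeasurable
    φ.continuous.aestronglyMeasurable hg.aestronglyMeasurable (Eventually.of_forall fun y => ?_)
    (Eventually.of_forall hex) ?_
  · exact hφ.convolutionExists_right_of_continuous_left _ h.continuous
      φ.continuous.locallyIntegrable y
  · refine convolutionExistsAt_of_linear_growth (A := (∫ u, ‖φ u‖) * A) (C := (∫ u, ‖φ u‖) * C) _
      h.integrable.norm (by simpa using h.integrable_abs_mul_norm)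
      (hφ.norm.continuous_convolution_left _ φ.continuous.norm hg.norm.locallyIntegrable) ?_ x
    intro s t
    have hex' : ∀ x, Integrable fun u => ‖φ u‖ * ‖g (x - u)‖ := hex
    simp only [MeasureTheory.convolution, mul_apply']
    rw [← integral_sub (hex' (t - s)) (hex' t)]
    calc _ ≤ ∫ u, ‖φ u‖ * (A + C * |s|) := by
          refine norm_integral_le_of_norm_le (φ.integrable.norm.mul_const _)
            (Eventually.of_forall fun u => ?_)
          rw [← mul_sub, norm_mul, norm_norm, sub_right_comm]
          gcongr
          exact hgr' s (t - u)
      _ = _ := by rw [integral_mul_const]; ring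

/-- A Schwartz function whose Fourier transform has compact support is a finite sum of
convolutions of members of a family of Schwartz functions without common zero of the Fourier
transforms with Schwartz functions. -/
theorem SchwartzMap.exists_eq_sum_convolution (k : 𝓢(ℝ, ℂ)) (hk : HasCompactSupport (𝓕 k : 𝓢(ℝ, ℂ)))
    (φ : ℝ → 𝓢(ℝ, ℂ)) (hφ : ∀ ω, 𝓕 (φ ω) ω ≠ 0) :
    ∃ (t : Finset ℝ) (h : ℝ → 𝓢(ℝ, ℂ)), ∀ x,
      k x = ∑ i ∈ t, (h i ⋆[lsmul ℂ ℂ] φ i) x := by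
  obtain ⟨t, -, ht⟩ := hk.isCompact.elim_nhds_subcover (fun i => {ω | 𝓕 (φ i) ω ≠ 0})
    fun i _ => (𝓕 (φ i)).continuous.continuousAt.eventually_ne (hφ i)
  let S : ℝ → ℂ := fun ω => ∑ i ∈ t, (starRingEnd ℂ) (𝓕 (φ i) ω) * 𝓕 (φ i) ω
  have hS : ∀ ω ∈ tsupport (𝓕 k : 𝓢(ℝ, ℂ)), S ω ≠ 0 := by
    intro ω hω
    obtain ⟨i, hi, hiω⟩ := Set.mem_iUnion₂.1 (ht hω)
    have hSr : S ω = ((∑ j ∈ t, ‖𝓕 (φ j) ω‖ ^ 2 : ℝ) : ℂ) := by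
      simp only [S, Complex.conj_mul', Complex.ofReal_sum, Complex.ofReal_pow]
    rw [hSr, Complex.ofReal_ne_zero]
    exact (Finset.sum_pos' (fun j _ => by positivity) ⟨i, hi, by
      have := norm_pos_iff.2 hiω; positivity⟩).ne'
  have hconj : ∀ i, ContDiff ℝ (⊤ : ℕ∞) fun ω => (starRingEnd ℂ) (𝓕 (φ i) ω) := fun i =>
    Complex.conjCLE.contDiff.comp (𝓕 (φ i)).smooth'
  have hSd : ContDiff ℝ (⊤ : ℕ∞) S := ContDiff.sum fun i _ => (hconj i).mul (𝓕 (φ i)).smooth'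
  let m : ℝ → ℝ → ℂ := fun i ω => (starRingEnd ℂ) (𝓕 (φ i) ω) * (S ω)⁻¹ * 𝓕 k ω
  have hmc : ∀ i, HasCompactSupport (m i) := fun i => hk.mul_left
  have hmd : ∀ i, ContDiff ℝ (⊤ : ℕ∞) (m i) := fun i => by
    refine contDiff_iff_contDiffAt.2 fun ω => ?_
    by_cases hω : ω ∈ tsupport (𝓕 k : 𝓢(ℝ, ℂ))
    · exact ((hconj i).contDiffAt.mul (hSd.contDiffAt.inv (hS ω hω))).mul (𝓕 k).smooth'.contDiffAt
    · refine (contDiffAt_const (c := (0 : ℂ))).congr_of_eventuallyEq ?_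
      filter_upwards [notMem_tsupport_iff_eventuallyEq.1 hω] with y hy
      simp [m, hy]
  let h : ℝ → 𝓢(ℝ, ℂ) := fun i => 𝓕⁻ ((hmc i).toSchwartzMap (hmd i))
  have hF : ∀ i ω, 𝓕 (h i) ω = m i ω := fun i ω => by
    simp only [h, fourier_fourierInv_eq]
    rfl
  refine ⟨t, h, fun x => ?_⟩
  have hsum : k = ∑ i ∈ t, SchwartzMap.convolution (lsmul ℂ ℂ) (h i) (φ i) := by
    refine (FourierTransform.fourierEquiv ℂ 𝓢(ℝ, ℂ)).injective ?_
    rw [map_sum]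
    ext ω
    simp only [FourierTransform.fourierEquiv_apply, _root_.sum_apply]
    have hterm : ∀ i, 𝓕 (SchwartzMap.convolution (lsmul ℂ ℂ) (h i) (φ i)) ω
        = m i ω * 𝓕 (φ i) ω := fun i => by
      rw [SchwartzMap.fourier_convolution_apply, Real.fourier_smul_convolution_eq
        (h i).integrable (φ i).integrable, ← SchwartzMap.fourier_coe, ← SchwartzMap.fourier_coe,
        hF, smul_eq_mul]
    simp only [hterm, m]
    by_cases hω : ω ∈ tsupport (𝓕 k : 𝓢(ℝ, ℂ))
    · calc 𝓕 k ω = S ω * (S ω)⁻¹ * 𝓕 k ω := by rw [mul_inv_cancel₀ (hS ω hω), one_mul]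
        _ = _ := by
          simp only [S, Finset.sum_mul]
          exact Finset.sum_congr rfl fun i _ => by ring
    · simp [image_eq_zero_of_notMem_tsupport hω]
  conv_lhs => rw [hsum]
  simp only [_root_.sum_apply, SchwartzMap.convolution_apply]

/-- If a uniformly continuous function becomes vanishing at infinity after convolution with each
member of a family of compactly supported Schwartz functions whose Fourier transforms have no
common zero, then it vanishes at infinity when convolved with a band-limited Schwartz function. -/
theorem UniformContinuous.tendsto_convolution_of_bandlimited {g : ℝ → X} (hg : UniformContinuous g)
    (φ : ℝ → 𝓢(ℝ, ℂ)) (hφ : ∀ ω, 𝓕 (φ ω) ω ≠ 0) (hφc : ∀ ω, HasCompactSupport (φ ω))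
    (h0 : ∀ ω, Tendsto (φ ω ⋆[lsmul ℂ ℂ] g) (cocompact ℝ) (𝓝 0))
    (k : 𝓢(ℝ, ℂ)) (hk : HasCompactSupport (𝓕 k : 𝓢(ℝ, ℂ))) :
    Tendsto (k ⋆[lsmul ℂ ℂ] g) (cocompact ℝ) (𝓝 0) := by
  obtain ⟨C, -, hC⟩ := hg.norm_sub_le_add_mul_abs one_pos
  obtain ⟨t, h, ht⟩ := k.exists_eq_sum_convolution hk φ hφ
  have heq : (k ⋆[lsmul ℂ ℂ] g) =
      fun x => ∑ i ∈ t, (h i ⋆[lsmul ℂ ℂ] (φ i ⋆[lsmul ℂ ℂ] g)) x := by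
    ext x
    simp only [← SchwartzMap.convolution_assoc_of_linear_growth _ _ (hφc _) hg.continuous hC]
    rw [convolution_lsmul]
    simp only [ht, Finset.sum_smul]
    rw [integral_finsetSum]
    · rfl
    · intro i _
      have := convolutionExistsAt_of_linear_growth (lsmul ℂ ℂ)
        (SchwartzMap.convolution (lsmul ℂ ℂ) (h i) (φ i)).integrable
        (SchwartzMap.integrable_abs_mul_norm _) hg.continuous hC x
      simpa only [ConvolutionExistsAt, SchwartzMap.convolution_apply, lsmul_apply] using this
  rw [heq, ← Finset.sum_const_zero (s := t)]
  exact tendsto_finsetSum _ fun i _ => Continuous.tendsto_convolution_cocompact (h i).integrable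
    ((hφc i).continuous_convolution_left _ (φ i).continuous hg.continuous.locallyIntegrable) (h0 i)

/-- There are Schwartz functions with compactly supported Fourier transform and integral one. -/
theorem SchwartzMap.exists_bandlimited_integral_eq_one :
    ∃ k : 𝓢(ℝ, ℂ), HasCompactSupport (𝓕 k : 𝓢(ℝ, ℂ)) ∧ ∫ s, k s = 1 := by
  let b : ContDiffBump (0 : ℝ) := default
  have hc : HasCompactSupport fun x => (b x : ℂ) :=
    b.hasCompactSupport.comp_left (g := fun r : ℝ => (r : ℂ)) Complex.ofReal_zero
  have hd : ContDiff ℝ (⊤ : ℕ∞) fun x => (b x : ℂ) := Complex.ofRealCLM.contDiff.comp b.contDiff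
  have hF : ⇑(𝓕 (𝓕⁻ (hc.toSchwartzMap hd)) : 𝓢(ℝ, ℂ)) = fun x => (b x : ℂ) := by
    rw [fourier_fourierInv_eq]
    rfl
  refine ⟨𝓕⁻ (hc.toSchwartzMap hd), by rwa [hF], ?_⟩
  have h0 := congrFun hF 0
  rw [SchwartzMap.fourier_coe, Real.fourier_real_eq_integral_exp_smul] at h0
  simpa [b.one_of_mem_closedBall (Metric.mem_closedBall_self b.rIn_pos.le)] using h0

/-- Dilating a Schwartz function keeps its integral and the compactness of the support of its
Fourier transform. -/
theorem SchwartzMap.exists_dilation (k : 𝓢(ℝ, ℂ)) (hk : HasCompactSupport (𝓕 k : 𝓢(ℝ, ℂ))) {r : ℝ}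
    (hr : 0 < r) : ∃ l : 𝓢(ℝ, ℂ), HasCompactSupport (𝓕 l : 𝓢(ℝ, ℂ)) ∧ ∀ s, l s = r * k (r * s) := by
  let e : ℝ ≃L[ℝ] ℝ := ContinuousLinearEquiv.smulLeft (Units.mk0 r hr.ne')
  let l : 𝓢(ℝ, ℂ) := (r : ℂ) • SchwartzMap.compCLMOfContinuousLinearEquiv ℂ e k
  have hl : ∀ s, l s = r * k (r * s) := fun s => rfl
  refine ⟨l, ?_, hl⟩
  have hF : ⇑(𝓕 l : 𝓢(ℝ, ℂ)) = fun w => 𝓕 k (r⁻¹ • w) := by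
    ext w
    rw [SchwartzMap.fourier_coe, SchwartzMap.fourier_coe, Real.fourier_real_eq_integral_exp_smul,
      Real.fourier_real_eq_integral_exp_smul]
    have := Measure.integral_comp_mul_left
      (fun u : ℝ => Complex.exp (↑(-2 * Real.pi * u * (r⁻¹ • w)) * Complex.I) • ((r : ℂ) * k u)) r
    calc _ = _ := integral_congr_ae (Eventually.of_forall fun s => ?_)
      _ = _ := this
      _ = _ := ?_
    · simp only [hl, smul_eq_mul]
      rw [show -2 * Real.pi * (r * s) * (r⁻¹ * w) = -2 * Real.pi * s * w by field_simp]
    · rw [← integral_smul]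
      refine integral_congr_ae (Eventually.of_forall fun u => ?_)
      have hrc : (r : ℂ) ≠ 0 := by exact_mod_cast hr.ne'
      simp only [smul_eq_mul, Complex.real_smul, abs_of_pos (inv_pos.2 hr), Complex.ofReal_inv]
      field_simp
  rw [hF]
  exact hk.comp_smul (inv_ne_zero hr.ne')

/-- A uniformly continuous function vanishes at infinity if its convolutions with all band-limited
Schwartz functions do. -/
theorem UniformContinuous.tendsto_of_bandlimited_convolution {g : ℝ → X} (hg : UniformContinuous g)
    (h0 : ∀ k : 𝓢(ℝ, ℂ), HasCompactSupport (𝓕 k : 𝓢(ℝ, ℂ)) →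
      Tendsto (k ⋆[lsmul ℂ ℂ] g) (cocompact ℝ) (𝓝 0)) :
    Tendsto g (cocompact ℝ) (𝓝 0) := by
  obtain ⟨k, hk, hk1⟩ := SchwartzMap.exists_bandlimited_integral_eq_one
  set M₀ : ℝ := ∫ s, ‖k s‖
  set M₁ : ℝ := ∫ s, |s| * ‖k s‖
  have hM₀0 : 0 ≤ M₀ := integral_nonneg fun s => norm_nonneg _
  have hM₁0 : 0 ≤ M₁ := integral_nonneg fun s => by positivity
  rw [Metric.tendsto_nhds]
  intro ε hε
  obtain ⟨C, hC0, hC⟩ := hg.norm_sub_le_add_mul_abs (ε := ε / (3 * (M₀ + 1))) (by positivity)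
  set r : ℝ := 3 * (C * M₁ + 1) / ε with hr_def
  have hr : 0 < r := by positivity
  obtain ⟨l, hl, hls⟩ := k.exists_dilation hk hr
  have hl1 : ∫ s, l s = 1 := by
    simp only [hls]
    rw [integral_const_mul, Measure.integral_comp_mul_left (fun s => k s) r, hk1,
      abs_of_pos (inv_pos.2 hr)]
    have hrc : (r : ℂ) ≠ 0 := by exact_mod_cast hr.ne'
    simp [hrc]
  have hl0 : ∫ s, ‖l s‖ = M₀ := by
    simp only [hls, norm_mul, Complex.norm_real, Real.norm_of_nonneg hr.le]
    rw [integral_const_mul, Measure.integral_comp_mul_left (fun s => ‖k s‖) r,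
      abs_of_pos (inv_pos.2 hr), smul_eq_mul, mul_inv_cancel_left₀ hr.ne']
  have hlm : ∫ s, |s| * ‖l s‖ = M₁ / r := by
    have : ∀ s, |s| * ‖l s‖ = |r * s| * ‖k (r * s)‖ := fun s => by
      simp only [hls, norm_mul, Complex.norm_real, Real.norm_of_nonneg hr.le, abs_mul,
        abs_of_pos hr]
      ring
    simp only [this]
    rw [Measure.integral_comp_mul_left (fun s => |s| * ‖k s‖) r, abs_of_pos (inv_pos.2 hr),
      smul_eq_mul, div_eq_inv_mul]
  filter_upwards [(Metric.tendsto_nhds.1 (h0 l hl)) (ε / 3) (by positivity)] with t ht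
  rw [dist_zero_right] at ht ⊢
  have hex : Integrable fun s => l s • g (t - s) :=
    convolutionExistsAt_of_linear_growth (lsmul ℂ ℂ) l.integrable l.integrable_abs_mul_norm
      hg.continuous hC t
  have hdiff : ‖(l ⋆[lsmul ℂ ℂ] g) t - g t‖ ≤ ε / (3 * (M₀ + 1)) * M₀ + C * (M₁ / r) := by
    have : (l ⋆[lsmul ℂ ℂ] g) t - g t = ∫ s, l s • (g (t - s) - g t) := by
      simp only [smul_sub]
      rw [integral_sub hex (l.integrable.smul_const _), integral_smul_const, hl1, one_smul]
      rfl
    rw [this]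
    calc _ ≤ ∫ s, (ε / (3 * (M₀ + 1)) * ‖l s‖ + C * (|s| * ‖l s‖)) := by
          refine norm_integral_le_of_norm_le ((l.integrable.norm.const_mul _).add
            (l.integrable_abs_mul_norm.const_mul _)) (Eventually.of_forall fun s => ?_)
          rw [norm_smul]
          nlinarith [hC s t, norm_nonneg (l s)]
      _ = _ := by
          rw [integral_add (l.integrable.norm.const_mul _)
            (l.integrable_abs_mul_norm.const_mul _), integral_const_mul, integral_const_mul,
            hl0, hlm]
  have e1 : ε / (3 * (M₀ + 1)) * M₀ ≤ ε / 3 := by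
    rw [div_mul_eq_mul_div, div_le_div_iff₀ (by positivity) (by positivity)]
    nlinarith
  have e2 : C * (M₁ / r) ≤ ε / 3 := by
    have hεr : ε * r = 3 * (C * M₁ + 1) := by rw [hr_def]; field_simp
    rw [← mul_div_assoc, div_le_iff₀ hr]
    linarith
  linarith [norm_le_norm_add_norm_sub ((l ⋆[lsmul ℂ ℂ] g) t) (g t)]

/-- Convolutions with two compactly supported continuous functions commute. -/
theorem convolution_left_comm_of_hasCompactSupport {F : ℝ → X} (hF : LocallyIntegrable F)
    {φ ψ : ℝ → ℂ} (hφ : Continuous φ) (hφc : HasCompactSupport φ) (hψ : Continuous ψ)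
    (hψc : HasCompactSupport ψ) :
    φ ⋆[lsmul ℂ ℂ] (ψ ⋆[lsmul ℂ ℂ] F) = ψ ⋆[lsmul ℂ ℂ] (φ ⋆[lsmul ℂ ℂ] F) := by
  have hFn : LocallyIntegrable fun t => ‖F t‖ := fun x =>
    let ⟨s, hs, h⟩ := hF x
    ⟨s, hs, h.norm⟩
  have assoc : ∀ {a b : ℝ → ℂ}, Continuous a → HasCompactSupport a → Continuous b →
      HasCompactSupport b →
      (a ⋆[lsmul ℂ ℂ] b) ⋆[lsmul ℂ ℂ] F = a ⋆[lsmul ℂ ℂ] (b ⋆[lsmul ℂ ℂ] F) := by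
    intro a b ha hac hb hbc
    ext x
    refine convolution_assoc _ _ _ _ mul_smul ha.aestronglyMeasurable
      hb.aestronglyMeasurable hF.aestronglyMeasurable (Eventually.of_forall fun y => ?_)
      (Eventually.of_forall fun y => ?_) ?_
    · exact hac.convolutionExists_left _ ha hb.locallyIntegrable y
    · exact hbc.norm.convolutionExists_left _ hb.norm hFn y
    · exact hac.norm.convolutionExists_left _ ha.norm
        (hbc.norm.continuous_convolution_left _ hb.norm hFn).locallyIntegrable x
  have comm : φ ⋆[lsmul ℂ ℂ] ψ = ψ ⋆[lsmul ℂ ℂ] φ := by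
    ext x
    rw [convolution_eq_swap, convolution_lsmul]
    simp only [lsmul_apply, smul_eq_mul, mul_comm]
  rw [← assoc hφ hφc hψ hψc, comm, assoc hψ hψc hφ hφc]

end

theorem convS_eq_convolution {X : Type*} [NormedAddCommGroup X] [NormedSpace ℂ X]
    (φ : ℝ → ℂ) (F : ℝ → X) :
    (fun t => convS φ F t) = φ ⋆[lsmul ℂ ℂ] F := by
  ext t
  rw [convolution_eq_swap]
  rfl

theorem fourier_eq_fourierInt (f : ℝ → ℂ) (ω : ℝ) :
    𝓕 f ω = fourierInt f (2 * Real.pi * ω) := by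
  rw [Real.fourier_real_eq_integral_exp_smul]
  refine integral_congr_ae (Eventually.of_forall fun t => ?_)
  simp only [smul_eq_mul]
  congr 2
  push_cast
  ring

/-- Let `F` be strongly measurable and locally integrable such that every
`ω ∈ ℝ` admits a smooth compactly supported `φ` with `φ̂(ω) ≠ 0` and `F∗φ ∈ C₀(ℝ,X)`. If
`ψ` is smooth, compactly supported, and `F∗ψ` is uniformly continuous, then
`F∗ψ ∈ C₀(ℝ,X)`. -/
theorem conv_mem_C0_of_uniformly_continuous {X : Type*} [NormedAddCommGroup X]
    [NormedSpace ℂ X] [CompleteSpace X] (F : ℝ → X)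
    (hFm : StronglyMeasurable F) (hFl : LocallyIntegrable F)
    (hsp : ∀ ω : ℝ, ∃ φ : ℝ → ℂ, ContDiff ℝ (⊤ : ℕ∞) φ ∧ HasCompactSupport φ ∧
      fourierInt φ ω ≠ 0 ∧ IsCZero (fun t => convS φ F t))
    (ψ : ℝ → ℂ) (hψ₁ : ContDiff ℝ (⊤ : ℕ∞) ψ) (hψ₂ : HasCompactSupport ψ)
    (hUC : UniformContinuous (fun t => convS ψ F t)) :
    IsCZero (fun t => convS ψ F t) := by
  choose φ hφs hφc hφ0 hφC using fun ω : ℝ => hsp (2 * Real.pi * ω)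
  simp only [convS_eq_convolution] at hφC hUC ⊢
  refine ⟨hUC.continuous, tendsto_zero_iff_norm_tendsto_zero.1 ?_⟩
  refine hUC.tendsto_of_bandlimited_convolution fun k hk =>
    hUC.tendsto_convolution_of_bandlimited (fun ω => (hφc ω).toSchwartzMap (hφs ω))
      (fun ω => ?_) hφc (fun ω => ?_) k hk
  · rw [SchwartzMap.fourier_coe, fourier_eq_fourierInt]
    exact hφ0 ω
  · change Tendsto (φ ω ⋆[lsmul ℂ ℂ] (ψ ⋆[lsmul ℂ ℂ] F)) _ _
    rw [convolution_left_comm_of_hasCompactSupport hFl (hφs ω).continuous (hφc ω)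
      hψ₁.continuous hψ₂]
    exact Continuous.tendsto_convolution_cocompact
      (hψ₁.continuous.integrable_of_hasCompactSupport hψ₂) (hφC ω).1
      (tendsto_zero_iff_norm_tendsto_zero.2 (hφC ω).2)
end
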